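/- arXiv:1506.04216 — 2 statements merged into one kernel-verified Lean document; each statement's English description precedes it below -/
import Mathlib

section
/- (Lemma 9 / appendix lemma) Under the same setting as Lemma 3 and assuming additionally that v and v* lie in the column space of U, the squared dual optimality gap is bounded as ‖v − v*‖² ≤ (8/γ') E_i[‖x⁺(i) − x*‖²_{(I+Z−2Z̃)²}] + (8/γ') E_i[‖x − x⁺(i)‖²_{Z̃²}] + (16 α² L/γ') p(y) + (2Γ'/γ') E_i[‖v − v⁺(i)‖²] + (8 α² (2L − μ)/γ') [f(x) − f(x*) − ⟨∇f(x*), x − x*⟩], where γ' is the smallest nonzero eigenvalue and Γ' the largest eigenvalue of Z̃ − Z, and E_i denotes the uniform average over joint indices. -/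
open Finset
open scoped RealInnerProductSpace

noncomputable section

/-- Block vectors of `ℝ^{Np}`: one vector of `ℝᵖ` per node. -/
abbrev Evec (p : ℕ) := EuclideanSpace ℝ (Fin p)

/-- The local objective of node `n`: `f_n(w) = (1/q_n) ∑_i f_{n,i}(w)`. -/
def locf {N p : ℕ} {q : Fin N → ℕ}
    (f : (n : Fin N) → Fin (q n) → Evec p → ℝ) (n : Fin N) (w : Evec p) : ℝ :=
  (q n : ℝ)⁻¹ * ∑ i, f n i w

/-- The local stochastic averaging gradient of node `n` for index choice `j`:
`ĝ_n(j) = ∇f_{n,j}(x_n) − ∇f_{n,j}(y_{n,j}) + (1/q_n) ∑_i ∇f_{n,i}(y_{n,i})`. -/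
def hatg {N p : ℕ} {q : Fin N → ℕ}
    (f : (n : Fin N) → Fin (q n) → Evec p → ℝ)
    (x : Fin N → Evec p)
    (y : (n : Fin N) → Fin (q n) → Evec p)
    (n : Fin N) (j : Fin (q n)) : Evec p :=
  gradient (f n j) (x n) - gradient (f n j) (y n j)
    + (q n : ℝ)⁻¹ • ∑ i, gradient (f n i) (y n i)

/-- `p(y) = ∑_n (1/q_n) ∑_i [f_{n,i}(y_{n,i}) − f_{n,i}(x̃*) − ⟨∇f_{n,i}(x̃*), y_{n,i} − x̃*⟩]`. -/
def ptbl {N p : ℕ} {q : Fin N → ℕ}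
    (f : (n : Fin N) → Fin (q n) → Evec p → ℝ)
    (xstar : Evec p)
    (y : (n : Fin N) → Fin (q n) → Evec p) : ℝ :=
  ∑ n, (q n : ℝ)⁻¹ * ∑ i,
    (f n i (y n i) - f n i xstar - ⟪gradient (f n i) xstar, y n i - xstar⟫)

/-- The aggregate optimality gap `f(x) − f(x*) − ⟨∇f(x*), x − x*⟩`, written blockwise. -/
def optgap {N p : ℕ} {q : Fin N → ℕ}
    (f : (n : Fin N) → Fin (q n) → Evec p → ℝ)
    (xstar : Evec p) (x : Fin N → Evec p) : ℝ :=
  ∑ n, (locf f n (x n) - locf f n xstar - ⟪gradient (locf f n) xstar, x n - xstar⟫)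

/-- The quadratic form `aᵀ (M ⊗ I_p) a` of an extended weight matrix, written blockwise. -/
def quadForm {N p : ℕ} (M : Matrix (Fin N) (Fin N) ℝ) (a : Fin N → Evec p) : ℝ :=
  ∑ n, ⟪a n, ∑ m, M n m • a m⟫

/-- The squared Euclidean norm of a block vector of `ℝ^{Np}`. -/
def sqnormB {N p : ℕ} (a : Fin N → Evec p) : ℝ := ∑ n, ‖a n‖^2

/-- The gradient table obtained from `y` by replacing, at each node `n`, the entry
`i n` by the current iterate `x n`. -/
def tblUpd {N p : ℕ} {q : Fin N → ℕ}
    (x : Fin N → Evec p)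
    (y : (n : Fin N) → Fin (q n) → Evec p)
    (i : (n : Fin N) → Fin (q n)) : (n : Fin N) → Fin (q n) → Evec p :=
  fun n => Function.update (y n) (i n) (x n)

end

section SmoothConvex

variable {E : Type*} [NormedAddCommGroup E] [InnerProductSpace ℝ E] [CompleteSpace E]
  {f : E → ℝ} {μ L : ℝ}

theorem hasDerivAt_comp_line (hf : Differentiable ℝ f) (x d : E) (t : ℝ) :
    HasDerivAt (fun s : ℝ => f (x + s • d)) ⟪gradient f (x + t • d), d⟫ t := by
  have hline : HasDerivAt (fun s : ℝ => x + s • d) d t := by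
    simpa using ((hasDerivAt_id t).smul_const d).const_add x
  exact (hf (x + t • d)).hasGradientAt.hasFDerivAt.comp_hasDerivAt t hline

/-- First-order characterization of strong convexity. -/
theorem StrongConvexOn.add_inner_gradient_le (hsc : StrongConvexOn Set.univ μ f)
    (hf : Differentiable ℝ f) (x d : E) :
    f x + ⟪gradient f x, d⟫ + μ / 2 * ‖d‖ ^ 2 ≤ f (x + d) := by
  have hconv : ConvexOn ℝ Set.univ
      (fun t : ℝ => f (x + t • d) - μ / 2 * ‖x + t • d‖ ^ 2) := by
    have h := (strongConvexOn_iff_convex.mp hsc).comp_affineMap (AffineMap.lineMap x (x + d))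
    simpa [Function.comp_def, AffineMap.lineMap_apply, add_comm] using h
  have hline : HasDerivAt (fun s : ℝ => x + s • d) d 0 := by
    simpa using ((hasDerivAt_id (0 : ℝ)).smul_const d).const_add x
  have hderiv := (hasDerivAt_comp_line hf x d 0).sub (hline.norm_sq.const_mul (μ / 2))
  have h := hconv.le_slope_of_hasDerivAt (Set.mem_univ 0) (Set.mem_univ 1) one_pos hderiv
  simp only [slope_def_field, zero_smul, one_smul, add_zero, sub_zero, div_one] at h
  rw [norm_add_sq_real] at h
  linarith

/-- Descent lemma: quadratic upper bound for functions with Lipschitz gradient. -/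
theorem le_add_inner_gradient_of_lipschitz (hf : Differentiable ℝ f)
    (hlip : ∀ a b, ‖gradient f a - gradient f b‖ ≤ L * ‖a - b‖) (x d : E) :
    f (x + d) ≤ f x + ⟪gradient f x, d⟫ + L / 2 * ‖d‖ ^ 2 := by
  have hderiv (t : ℝ) : HasDerivAt
      (fun s : ℝ => f (x + s • d) - s * ⟪gradient f x, d⟫ - s ^ 2 * (L / 2 * ‖d‖ ^ 2))
      (⟪gradient f (x + t • d), d⟫ - ⟪gradient f x, d⟫ - 2 * t * (L / 2 * ‖d‖ ^ 2)) t := by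
    have h1 := (hasDerivAt_id t).mul_const ⟪gradient f x, d⟫
    have h2 := (hasDerivAt_pow 2 t).mul_const (L / 2 * ‖d‖ ^ 2)
    refine (((hasDerivAt_comp_line hf x d t).sub h1).sub h2).congr_deriv ?_
    simp
  have hanti := antitoneOn_of_deriv_nonpos (convex_Icc (0 : ℝ) 1)
    (fun t _ => (hderiv t).continuousAt.continuousWithinAt)
    (fun t _ => (hderiv t).differentiableAt.differentiableWithinAt) (fun t ht => by
      rw [interior_Icc] at ht
      rw [(hderiv t).deriv, ← inner_sub_left]
      have h1 := real_inner_le_norm (gradient f (x + t • d) - gradient f x) d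
      have h2 := mul_le_mul_of_nonneg_right (hlip (x + t • d) x) (norm_nonneg d)
      rw [add_sub_cancel_left, norm_smul, Real.norm_of_nonneg ht.1.le] at h2
      nlinarith)
  have h := hanti (Set.left_mem_Icc.mpr zero_le_one) (Set.right_mem_Icc.mpr zero_le_one)
    zero_le_one
  simp only [one_smul, zero_smul, add_zero] at h
  linarith

/-- Squared gradient differences are controlled by the Bregman divergence. -/
theorem norm_gradient_sub_sq_le (hL : 0 < L) (hμ : 0 ≤ μ)
    (hsc : StrongConvexOn Set.univ μ f) (hf : Differentiable ℝ f)
    (hlip : ∀ a b, ‖gradient f a - gradient f b‖ ≤ L * ‖a - b‖) (x z : E) :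
    ‖gradient f x - gradient f z‖ ^ 2
      ≤ 2 * L * (f x - f z - ⟪gradient f z, x - z⟫) := by
  set g := gradient f x - gradient f z with hg
  have h1 := le_add_inner_gradient_of_lipschitz hf hlip x (-(L⁻¹ • g))
  have h2 := hsc.add_inner_gradient_le hf z (x - z + -(L⁻¹ • g))
  rw [show z + (x - z + -(L⁻¹ • g)) = x + -(L⁻¹ • g) by abel] at h2
  have h3 : 0 ≤ μ / 2 * ‖x - z + -(L⁻¹ • g)‖ ^ 2 := by positivity
  have h4 : ⟪gradient f x, g⟫ - ⟪gradient f z, g⟫ = ‖g‖ ^ 2 := by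
    rw [← inner_sub_left, ← hg, real_inner_self_eq_norm_sq]
  rw [inner_add_right, inner_neg_right, real_inner_smul_right] at h2
  rw [inner_neg_right, real_inner_smul_right, norm_neg, norm_smul, mul_pow,
    Real.norm_of_nonneg (inv_nonneg.mpr hL.le)] at h1
  have h5 : L⁻¹ * ‖g‖ ^ 2 - L / 2 * (L⁻¹ ^ 2 * ‖g‖ ^ 2)
      ≤ f x - f z - ⟪gradient f z, x - z⟫ := by
    rw [← h4] at h1 ⊢
    linarith
  have h6 : L⁻¹ * ‖g‖ ^ 2 - L / 2 * (L⁻¹ ^ 2 * ‖g‖ ^ 2) = ‖g‖ ^ 2 / (2 * L) := by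
    field_simp
    ring
  rw [h6, div_le_iff₀ (by positivity)] at h5
  linarith

end SmoothConvex

/-- Variance bound for the variance-reduced combination `A j - B j + mean B`. -/
theorem mean_norm_sub_add_mean_sq_le {E : Type*} [NormedAddCommGroup E]
    [InnerProductSpace ℝ E] {ι : Type*} [Fintype ι] [Nonempty ι] (A B : ι → E) :
    (Fintype.card ι : ℝ)⁻¹ * ∑ j, ‖A j - B j + (Fintype.card ι : ℝ)⁻¹ • ∑ i, B i‖ ^ 2
      ≤ 2 * ((Fintype.card ι : ℝ)⁻¹ * ∑ j, ‖A j‖ ^ 2)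
        + 2 * ((Fintype.card ι : ℝ)⁻¹ * ∑ j, ‖B j‖ ^ 2)
        - ‖(Fintype.card ι : ℝ)⁻¹ • ∑ j, A j‖ ^ 2 := by
  set c : ℝ := (Fintype.card ι : ℝ) with hc
  have hc0 : 0 < c := by rw [hc]; exact_mod_cast Fintype.card_pos
  set a := c⁻¹ • ∑ j, A j with ha
  set b := c⁻¹ • ∑ j, B j with hb
  have hA : ∑ j, A j = c • a := by rw [ha, smul_inv_smul₀ hc0.ne']
  have hB : ∑ j, B j = c • b := by rw [hb, smul_inv_smul₀ hc0.ne']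
  obtain ⟨K, hK⟩ : ∃ K : ℝ, K = ‖a‖ ^ 2 + 2 * ‖b‖ ^ 2 + 2 * ⟪b, a⟫ := ⟨_, rfl⟩
  have hpt (j : ι) : ‖A j - B j + b‖ ^ 2 ≤ 2 * ‖A j‖ ^ 2 + 2 * ‖B j‖ ^ 2
      - 2 * ⟪A j, a⟫ - 4 * ⟪B j, b⟫ - 2 * ⟪B j, a⟫ + K := by
    have h := parallelogram_law_with_norm ℝ (A j - a) (B j - b)
    have h1 : A j - B j + b = (A j - a - (B j - b)) + a := by abel
    have h2 := norm_add_sq_real (A j - a - (B j - b)) a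
    have h3 := norm_sub_sq_real (A j) a
    have h4 := norm_sub_sq_real (B j) b
    have h5 : ⟪A j - a - (B j - b), a⟫ = ⟪A j, a⟫ - ‖a‖ ^ 2 - ⟪B j, a⟫ + ⟪b, a⟫ := by
      simp only [inner_sub_left, real_inner_self_eq_norm_sq]; ring
    rw [h1, hK]
    nlinarith [sq_nonneg ‖A j - a + (B j - b)‖]
  have hsum := Finset.sum_le_sum fun j (_ : j ∈ Finset.univ) => hpt j
  simp only [Finset.sum_add_distrib, Finset.sum_sub_distrib, ← Finset.mul_sum, ← sum_inner, hA,
    hB, real_inner_smul_left, real_inner_self_eq_norm_sq, Finset.sum_const, Finset.card_univ,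
    nsmul_eq_mul, ← hc] at hsum
  have hscaled := mul_le_mul_of_nonneg_left hsum (inv_nonneg.mpr hc0.le)
  refine hscaled.trans ?_
  have hrw : c⁻¹ * (2 * ∑ j, ‖A j‖ ^ 2 + 2 * ∑ j, ‖B j‖ ^ 2 - 2 * (c * ‖a‖ ^ 2)
      - 4 * (c * ‖b‖ ^ 2) - 2 * (c * ⟪b, a⟫) + c * K)
      = 2 * (c⁻¹ * ∑ j, ‖A j‖ ^ 2) + 2 * (c⁻¹ * ∑ j, ‖B j‖ ^ 2) - ‖a‖ ^ 2 - 2 * ‖b‖ ^ 2 := by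
    rw [hK]
    field_simp
    ring
  rw [hrw]
  nlinarith [sq_nonneg ‖b‖]

section UniformIndex

/-- Under the uniform distribution on joint indices, each coordinate is uniform. -/
theorem mean_pi_eval {N : ℕ} {q : Fin N → ℕ} (hq : ∀ n, 0 < q n)
    (φ : (n : Fin N) → Fin (q n) → ℝ) (n : Fin N) :
    (∏ m, (q m : ℝ))⁻¹ * ∑ i : (m : Fin N) → Fin (q m), φ n (i n)
      = (q n : ℝ)⁻¹ * ∑ j, φ n j := by
  have h := Finset.prod_univ_sum (fun m => (Finset.univ : Finset (Fin (q m))))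
    (fun m j => if m = n then φ m j else 1)
  simp only [Fintype.piFinset_univ, Finset.prod_ite_eq', Finset.mem_univ, if_true] at h
  rw [← h, ← Finset.prod_inv_distrib, ← Finset.prod_mul_distrib, Finset.prod_eq_single n]
  · simp
  · intro m _ hm
    have : (q m : ℝ) ≠ 0 := by exact_mod_cast (hq m).ne'
    simp [hm, this]
  · simp

theorem mean_pi_sum_eval {N : ℕ} {q : Fin N → ℕ} (hq : ∀ n, 0 < q n)
    (φ : (n : Fin N) → Fin (q n) → ℝ) :
    (∏ m, (q m : ℝ))⁻¹ * ∑ i : (m : Fin N) → Fin (q m), ∑ n, φ n (i n)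
      = ∑ n, (q n : ℝ)⁻¹ * ∑ j, φ n j := by
  rw [Finset.sum_comm, Finset.mul_sum]
  exact Finset.sum_congr rfl fun n _ => mean_pi_eval hq φ n

end UniformIndex

section BlockVectors

variable {N p : ℕ}

/-- The action of `M ⊗ I_p` on a block vector. -/
def bmul (M : Matrix (Fin N) (Fin N) ℝ) (a : Fin N → Evec p) : Fin N → Evec p :=
  fun n => ∑ m, M n m • a m

theorem bmul_bmul (A B : Matrix (Fin N) (Fin N) ℝ) (a : Fin N → Evec p) :
    bmul A (bmul B a) = bmul (A * B) a := by
  funext n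
  simp only [bmul, Finset.smul_sum, smul_smul, Matrix.mul_apply, Finset.sum_smul]
  exact Finset.sum_comm

theorem bmul_one (a : Fin N → Evec p) : bmul 1 a = a := by
  funext n
  simp [bmul, Matrix.one_apply]

theorem bmul_add_mat (A B : Matrix (Fin N) (Fin N) ℝ) (a : Fin N → Evec p) :
    bmul (A + B) a = bmul A a + bmul B a := by
  funext n
  simp [bmul, add_smul, Finset.sum_add_distrib]

theorem bmul_sub_mat (A B : Matrix (Fin N) (Fin N) ℝ) (a : Fin N → Evec p) :
    bmul (A - B) a = bmul A a - bmul B a := by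
  funext n
  simp [bmul, sub_smul, Finset.sum_sub_distrib]

theorem bmul_smul_mat (c : ℝ) (A : Matrix (Fin N) (Fin N) ℝ) (a : Fin N → Evec p) :
    bmul (c • A) a = c • bmul A a := by
  funext n
  simp [bmul, Finset.smul_sum, smul_smul]

theorem bmul_add (A : Matrix (Fin N) (Fin N) ℝ) (a b : Fin N → Evec p) :
    bmul A (a + b) = bmul A a + bmul A b := by
  funext n
  simp [bmul, smul_add, Finset.sum_add_distrib]

theorem bmul_sub (A : Matrix (Fin N) (Fin N) ℝ) (a b : Fin N → Evec p) :
    bmul A (a - b) = bmul A a - bmul A b := by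
  funext n
  simp [bmul, smul_sub, Finset.sum_sub_distrib]

theorem bmul_const {A : Matrix (Fin N) (Fin N) ℝ} (hA : A.mulVec (fun _ => 1) = 0)
    (w : Evec p) : bmul A (fun _ => w) = 0 := by
  funext n
  have h := congrFun hA n
  simp only [Matrix.mulVec, dotProduct, mul_one, Pi.zero_apply] at h
  simp [bmul, ← Finset.sum_smul, h]

theorem sum_inner_bmul {A : Matrix (Fin N) (Fin N) ℝ} (hA : A.IsSymm)
    (a b : Fin N → Evec p) : ∑ n, ⟪a n, bmul A b n⟫ = ∑ n, ⟪bmul A a n, b n⟫ := by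
  simp only [bmul, inner_sum, sum_inner, real_inner_smul_left, real_inner_smul_right]
  rw [Finset.sum_comm]
  simp only [hA.apply]

theorem quadForm_mul_self {A : Matrix (Fin N) (Fin N) ℝ} (hA : A.IsSymm)
    (a : Fin N → Evec p) : quadForm (A * A) a = sqnormB (bmul A a) := by
  have h : quadForm (A * A) a = ∑ n, ⟪a n, bmul A (bmul A a) n⟫ := by
    rw [bmul_bmul]; rfl
  rw [h, sum_inner_bmul hA]
  simp only [sqnormB, real_inner_self_eq_norm_sq]

theorem sqnormB_sub_le (a b : Fin N → Evec p) :
    sqnormB (a - b) ≤ 2 * sqnormB a + 2 * sqnormB b := by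
  simp only [sqnormB, Finset.mul_sum, ← Finset.sum_add_distrib]
  refine Finset.sum_le_sum fun n _ => ?_
  have h := parallelogram_law_with_norm ℝ (a n) (b n)
  rw [Pi.sub_apply]
  nlinarith [sq_nonneg ‖a n + b n‖]

theorem sqnormB_neg (a : Fin N → Evec p) : sqnormB (-a) = sqnormB a := by
  simp [sqnormB]

theorem sqnormB_smul (c : ℝ) (a : Fin N → Evec p) :
    sqnormB (c • a) = c ^ 2 * sqnormB a := by
  simp [sqnormB, norm_smul, mul_pow, Finset.mul_sum]

/-- A symmetric matrix and its square have the same column space. -/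
theorem exists_bmul_mul_self {A : Matrix (Fin N) (Fin N) ℝ} (hA : A.IsSymm)
    (a : Fin N → Evec p) : ∃ b, bmul (A * A) b = bmul A a := by
  have hle : LinearMap.range (A * A).mulVecLin ≤ LinearMap.range A.mulVecLin := by
    rw [Matrix.mulVecLin_mul]
    exact LinearMap.range_comp_le_range _ _
  have hrank : (A * A).rank = A.rank := by
    have h := Matrix.rank_self_mul_transpose A
    rwa [hA.eq] at h
  have heq := Submodule.eq_of_le_of_finrank_eq hle hrank
  have hcol (k : Fin p) : ∃ b : Fin N → ℝ, (A * A).mulVec b = A.mulVec fun m => a m k := by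
    have h : A.mulVecLin (fun m => a m k) ∈ LinearMap.range A.mulVecLin :=
      LinearMap.mem_range_self _ _
    rw [← heq] at h
    exact h
  choose b hb using hcol
  refine ⟨fun m => WithLp.toLp 2 fun k => b k m, ?_⟩
  funext n
  ext k
  simpa [bmul, Matrix.mulVec, dotProduct] using congrFun (hb k) n

end BlockVectors

section Aggregate

variable {N p : ℕ} {q : Fin N → ℕ}

theorem gradient_locf {f : (n : Fin N) → Fin (q n) → Evec p → ℝ}
    (hdiff : ∀ n i, Differentiable ℝ (f n i)) (n : Fin N) (w : Evec p) :
    gradient (locf f n) w = (q n : ℝ)⁻¹ • ∑ i, gradient (f n i) w := by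
  refine HasGradientAt.gradient ?_
  rw [hasGradientAt_iff_hasFDerivAt, map_smul, map_sum]
  exact (HasFDerivAt.fun_sum fun i _ => (hdiff n i w).hasGradientAt.hasFDerivAt).const_mul _

/-- Second-moment bound for the stochastic averaging gradient around `∇f(x*)`. -/
theorem mean_sqnormB_hatg_sub_le (hq : ∀ n, 0 < q n) {μ L : ℝ} (hμ : 0 < μ) (hμL : μ ≤ L)
    {f : (n : Fin N) → Fin (q n) → Evec p → ℝ}
    (hdiff : ∀ n i, Differentiable ℝ (f n i))
    (hsc : ∀ n i, StrongConvexOn Set.univ μ (f n i))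
    (hlip : ∀ n i a b, ‖gradient (f n i) a - gradient (f n i) b‖ ≤ L * ‖a - b‖)
    (xstar : Evec p) (x : Fin N → Evec p) (y : (n : Fin N) → Fin (q n) → Evec p) :
    (∏ n, (q n : ℝ))⁻¹ * ∑ i : (n : Fin N) → Fin (q n),
        sqnormB (fun n => hatg f x y n (i n) - gradient (locf f n) xstar)
      ≤ 4 * L * ptbl f xstar y + 2 * (2 * L - μ) * optgap f xstar x := by
  have hL : 0 < L := hμ.trans_le hμL
  simp only [sqnormB]
  rw [mean_pi_sum_eval hq fun n j => ‖hatg f x y n j - gradient (locf f n) xstar‖ ^ 2]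
  simp only [ptbl, optgap, Finset.mul_sum (s := (Finset.univ : Finset (Fin N))),
    ← Finset.sum_add_distrib]
  refine Finset.sum_le_sum fun n _ => ?_
  have : Nonempty (Fin (q n)) := ⟨⟨0, hq n⟩⟩
  have hc0 : (0 : ℝ) < q n := by exact_mod_cast hq n
  set c : ℝ := (q n : ℝ) with hc
  set A : Fin (q n) → Evec p := fun j => gradient (f n j) (x n) - gradient (f n j) xstar with hA
  set B : Fin (q n) → Evec p := fun j => gradient (f n j) (y n j) - gradient (f n j) xstar with hB
  have hvar := mean_norm_sub_add_mean_sq_le A B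
  rw [Fintype.card_fin, ← hc] at hvar
  have hvec (j : Fin (q n)) : hatg f x y n j - gradient (locf f n) xstar
      = A j - B j + c⁻¹ • ∑ i, B i := by
    rw [gradient_locf hdiff, hatg, hA, hB]
    simp only [Finset.sum_sub_distrib, smul_sub]
    abel
  simp only [hvec]
  have hAle := mul_le_mul_of_nonneg_left (Finset.sum_le_sum fun j (_ : j ∈ Finset.univ) =>
    norm_gradient_sub_sq_le hL hμ.le (hsc n j) (hdiff n j) (hlip n j) (x n) xstar)
    (inv_nonneg.mpr hc0.le)
  have hBle := mul_le_mul_of_nonneg_left (Finset.sum_le_sum fun j (_ : j ∈ Finset.univ) =>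
    norm_gradient_sub_sq_le hL hμ.le (hsc n j) (hdiff n j) (hlip n j) (y n j) xstar)
    (inv_nonneg.mpr hc0.le)
  rw [← Finset.mul_sum, mul_left_comm] at hAle hBle
  have hgap : locf f n (x n) - locf f n xstar - ⟪gradient (locf f n) xstar, x n - xstar⟫
      = c⁻¹ * ∑ j, (f n j (x n) - f n j xstar - ⟪gradient (f n j) xstar, x n - xstar⟫) := by
    rw [gradient_locf hdiff, real_inner_smul_left, sum_inner]
    simp only [locf, Finset.sum_sub_distrib]
    ring
  have hstrong : 2 * μ * (c⁻¹ * ∑ j, (f n j (x n) - f n j xstar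
      - ⟪gradient (f n j) xstar, x n - xstar⟫)) ≤ ‖c⁻¹ • ∑ j, A j‖ ^ 2 := by
    have hpt (j : Fin (q n)) : f n j (x n) - f n j xstar - ⟪gradient (f n j) xstar, x n - xstar⟫
        ≤ ⟪A j, x n - xstar⟫ - μ / 2 * ‖x n - xstar‖ ^ 2 := by
      have h := (hsc n j).add_inner_gradient_le (hdiff n j) (x n) (-(x n - xstar))
      rw [show x n + -(x n - xstar) = xstar by abel, inner_neg_right, norm_neg] at h
      simp only [hA, inner_sub_left (gradient (f n j) (x n))]
      linarith
    have hsum := mul_le_mul_of_nonneg_left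
      (Finset.sum_le_sum fun j (_ : j ∈ Finset.univ) => hpt j) (inv_nonneg.mpr hc0.le)
    rw [Finset.sum_sub_distrib _ (fun _ => μ / 2 * ‖x n - xstar‖ ^ 2), ← sum_inner, mul_sub,
      ← real_inner_smul_left, Finset.sum_const, Finset.card_univ, Fintype.card_fin,
      nsmul_eq_mul, ← hc, inv_mul_cancel_left₀ hc0.ne'] at hsum
    have hcs := real_inner_le_norm (c⁻¹ • ∑ j, A j) (x n - xstar)
    have h2 := mul_le_mul_of_nonneg_left (hsum.trans (sub_le_sub_right hcs _))
      (by positivity : (0 : ℝ) ≤ 2 * μ)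
    nlinarith [sq_nonneg (‖c⁻¹ • ∑ j, A j‖ - μ * ‖x n - xstar‖)]
  rw [hgap]
  linarith

end Aggregate

/-- **Dual optimality gap bound (appendix lemma of the DSA paper).**
In the setting of Lemma 3, with `γ'` the smallest nonzero eigenvalue and `Γ'` the
largest eigenvalue of `Z̃ − Z` (characterized by their quadratic-form extremal
properties below), and with `v` and `v*` lying in the column space of `U`,
`‖v − v*‖² ≤ (8/γ') E_i ‖x⁺(i) − x*‖²_{(I+Z−2Z̃)²} + (8/γ') E_i ‖x − x⁺(i)‖²_{Z̃²}
  + (16 α² L/γ') p(y) + (2Γ'/γ') E_i ‖v − v⁺(i)‖²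
  + (8 α² (2L − μ)/γ') (f(x) − f(x*) − ⟨∇f(x*), x − x*⟩)`. -/
theorem dsa_dual_gap_bound
    {N p : ℕ} {q : Fin N → ℕ} (hq : ∀ n, 0 < q n)
    (μ L : ℝ) (hμ : 0 < μ) (hμL : μ ≤ L)
    (f : (n : Fin N) → Fin (q n) → Evec p → ℝ)
    (hdiff : ∀ n i, Differentiable ℝ (f n i))
    (hsc : ∀ n i, StrongConvexOn Set.univ μ (f n i))
    (hlip : ∀ n i a b, ‖gradient (f n i) a - gradient (f n i) b‖ ≤ L * ‖a - b‖)
    (W Wt Us : Matrix (Fin N) (Fin N) ℝ)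
    (hWsym : W.IsSymm) (hWtsym : Wt.IsSymm)
    (hnullW : ∀ v : Fin N → ℝ,
      ((1 : Matrix (Fin N) (Fin N) ℝ) - W).mulVec v = 0 ↔ ∃ c : ℝ, v = fun _ => c)
    (hnulldiff : ∀ v : Fin N → ℝ, (Wt - W).mulVec v = 0 ↔ ∃ c : ℝ, v = fun _ => c)
    (hnullWt : ((1 : Matrix (Fin N) (Fin N) ℝ) - Wt).mulVec (fun _ => (1:ℝ)) = 0)
    (hord1 : (Wt - W).PosSemidef)
    (hord2 : ((1 : Matrix (Fin N) (Fin N) ℝ) + W - (2:ℝ) • Wt).PosSemidef)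
    (hWtpos : Wt.PosDef)
    (hUs : Us.PosSemidef) (hUs2 : Us * Us = Wt - W)
    (γ' Γ' : ℝ) (hγ'pos : 0 < γ')
    (hγ' : ∀ w : Fin N → Evec p,
      (∃ a : Fin N → Evec p, ∀ n, w n = ∑ m, (Wt - W) n m • a m) →
        γ' * sqnormB w ≤ quadForm (Wt - W) w)
    (hγ'ach : ∃ w : Fin N → Evec p, w ≠ 0 ∧
      (∃ a : Fin N → Evec p, ∀ n, w n = ∑ m, (Wt - W) n m • a m) ∧
      quadForm (Wt - W) w = γ' * sqnormB w)
    (hΓ' : ∀ w : Fin N → Evec p, quadForm (Wt - W) w ≤ Γ' * sqnormB w)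
    (hΓ'ach : ∃ w : Fin N → Evec p, w ≠ 0 ∧ quadForm (Wt - W) w = Γ' * sqnormB w)
    (α : ℝ) (hα : 0 < α)
    (xstar : Evec p)
    (hxstar : ∀ w, ∑ n, locf f n xstar ≤ ∑ n, locf f n w)
    (vstar : Fin N → Evec p)
    (hvstar : ∀ n, α • gradient (locf f n) xstar + ∑ m, Us n m • vstar m = 0)
    (hvstarcol : ∃ a : Fin N → Evec p, ∀ n, vstar n = ∑ m, Us n m • a m)
    (x v : Fin N → Evec p)
    (hvcol : ∃ a : Fin N → Evec p, ∀ n, v n = ∑ m, Us n m • a m)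
    (y : (n : Fin N) → Fin (q n) → Evec p)
    (xp vp : ((n : Fin N) → Fin (q n)) → Fin N → Evec p)
    (hxp : ∀ i n, xp i n = x n - α • hatg f x y n (i n)
        - (x n - ∑ m, Wt n m • x m) - ∑ m, Us n m • v m)
    (hvp : ∀ i n, vp i n = v n + ∑ m, Us n m • xp i m) :
    sqnormB (fun n => v n - vstar n)
      ≤ (8 / γ') * ((∏ n, (q n : ℝ))⁻¹ * ∑ i : (n : Fin N) → Fin (q n),
            quadForm (((1 : Matrix (Fin N) (Fin N) ℝ) + W - (2:ℝ) • Wt)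
                * ((1 : Matrix (Fin N) (Fin N) ℝ) + W - (2:ℝ) • Wt))
              (fun n => xp i n - xstar))
        + (8 / γ') * ((∏ n, (q n : ℝ))⁻¹ * ∑ i : (n : Fin N) → Fin (q n),
            quadForm (Wt * Wt) (fun n => x n - xp i n))
        + (16 * α^2 * L / γ') * ptbl f xstar y
        + (2 * Γ' / γ') * ((∏ n, (q n : ℝ))⁻¹ * ∑ i : (n : Fin N) → Fin (q n),
            sqnormB (fun n => v n - vp i n))
        + (8 * α^2 * (2 * L - μ) / γ') * optgap f xstar x := by
  have hUsym : Us.IsSymm := by simpa using! hUs.isHermitian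
  set G : Matrix (Fin N) (Fin N) ℝ := 1 + W - (2 : ℝ) • Wt with hG
  have hGsym : G.IsSymm :=
    (Matrix.isSymm_one.add hWsym).sub (hWtsym.smul 2)
  have hW1 : (1 - W).mulVec (fun _ => (1 : ℝ)) = 0 := (hnullW _).mpr ⟨1, rfl⟩
  have hG1 : G.mulVec (fun _ => (1 : ℝ)) = 0 := by
    rw [show G = (2 : ℝ) • (1 - Wt) - (1 - W) by rw [hG]; module,
      Matrix.sub_mulVec, Matrix.smul_mulVec, hW1, hnullWt]
    simp
  have hqU (w : Fin N → Evec p) : quadForm (Wt - W) w = sqnormB (bmul Us w) := by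
    rw [← hUs2, quadForm_mul_self hUsym]
  have hlow : γ' * sqnormB (v - vstar) ≤ sqnormB (bmul Us (v - vstar)) := by
    obtain ⟨a, ha⟩ := hvcol
    obtain ⟨b, hb⟩ := hvstarcol
    obtain ⟨d, hd⟩ := exists_bmul_mul_self hUsym (a - b)
    rw [hUs2, bmul_sub, show bmul Us a = v from (funext ha).symm,
      show bmul Us b = vstar from (funext hb).symm] at hd
    rw [← hqU]
    exact hγ' _ ⟨d, fun n => (congrFun hd n).symm⟩
  set g : Fin N → Evec p := fun n => gradient (locf f n) xstar with hg
  have hUvstar : bmul Us vstar = -(α • g) :=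
    funext fun n => (neg_eq_of_add_eq_zero_right (hvstar n)).symm
  have hpt (i : (n : Fin N) → Fin (q n)) : γ' * sqnormB (v - vstar)
      ≤ 8 * quadForm (G * G) (fun n => xp i n - xstar)
        + 8 * quadForm (Wt * Wt) (fun n => x n - xp i n)
        + 2 * Γ' * sqnormB (fun n => v n - vp i n)
        + 4 * α ^ 2 * sqnormB (fun n => hatg f x y n (i n) - g n) := by
    set h : Fin N → Evec p := fun n => hatg f x y n (i n) with hh
    have hxp' : xp i = x - α • h - (x - bmul Wt x) - bmul Us v := funext (hxp i)
    have hvp' : vp i = v + bmul Us (xp i) := funext (hvp i)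
    have hkey : bmul Us (vp i - vstar)
        = bmul Wt (x - xp i) - bmul G (xp i - fun _ => xstar) - α • (h - g) := by
      have hUv : bmul Us v = bmul Wt x - α • h - xp i := by
        rw [hxp']; abel
      rw [hvp', bmul_sub, bmul_add, bmul_bmul, hUs2, hUvstar, hUv, bmul_sub, bmul_sub,
        bmul_const hG1, hG, bmul_sub_mat, bmul_sub_mat, bmul_add_mat, bmul_one, bmul_smul_mat]
      module
    have h1 := sqnormB_sub_le (bmul Us (v - vp i)) (-bmul Us (vp i - vstar))
    rw [sqnormB_neg, sub_neg_eq_add, ← bmul_add, sub_add_sub_cancel, hkey] at h1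
    have h2 := sqnormB_sub_le (bmul Wt (x - xp i) - bmul G (xp i - fun _ => xstar))
      (α • (h - g))
    have h3 := sqnormB_sub_le (bmul Wt (x - xp i)) (bmul G (xp i - fun _ => xstar))
    rw [sqnormB_smul] at h2
    have h4 := hΓ' (v - vp i)
    rw [hqU] at h4
    have h5 := quadForm_mul_self hGsym (xp i - fun _ => xstar)
    have h6 := quadForm_mul_self hWtsym (x - xp i)
    rw [show (fun n => xp i n - xstar) = xp i - fun _ => xstar from rfl,
      show (fun n => x n - xp i n) = x - xp i from rfl,
      show (fun n => v n - vp i n) = v - vp i from rfl,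
      show (fun n => hatg f x y n (i n) - g n) = h - g from rfl, h5, h6]
    linarith
  have hQ : 0 < ∏ n, (q n : ℝ) := Finset.prod_pos fun n _ => by exact_mod_cast hq n
  have hmean := mul_le_mul_of_nonneg_left
    (Finset.sum_le_sum fun i (_ : i ∈ Finset.univ) => hpt i) (inv_nonneg.mpr hQ.le)
  have hcard : ((Fintype.card ((n : Fin N) → Fin (q n)) : ℕ) : ℝ) = ∏ n, (q n : ℝ) := by
    simp
  rw [Finset.sum_const, Finset.card_univ, nsmul_eq_mul, hcard, inv_mul_cancel_left₀ hQ.ne'] at hmean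
  simp only [Finset.sum_add_distrib, ← Finset.mul_sum] at hmean
  have hvar := mul_le_mul_of_nonneg_left
    (mean_sqnormB_hatg_sub_le hq hμ hμL hdiff hsc hlip xstar x y)
    (by positivity : 0 ≤ 4 * α ^ 2)
  change sqnormB (v - vstar) ≤ _
  simp only [div_mul_eq_mul_div, ← add_div]
  rw [le_div_iff₀' hγ'pos]
  linarith
end

section
/- (Corollary 8, explicit convergence constant) In the setting of Theorem 5, additionally take W̃ = (I+W)/2, assign the same number q of instantaneous functions to every node (q_min = q_max = q), and set η = 2L²/μ, α = γμ/(8L²), c = (qγμ²/(4L³))(1 + μ/(4L)). Then η, α, c satisfy the interval conditions of Theorem 5, and the one-step contraction of Theorem 5 holds with δ = min{ 1/(16 κ_g²), 1/(q[1 + 4κ_f(1 + γ/γ')]), 1/(4(γ/γ')κ_f + 32 κ_g κ_f⁴) }, where κ_f = L/μ and κ_g = max{Γ, Γ'}/min{γ, γ'}. -/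
open Finset
open scoped RealInnerProductSpace

namespace DSA

section SmoothConvex

variable {F : Type*} [NormedAddCommGroup F] [InnerProductSpace ℝ F] [CompleteSpace F]

/-- The Bregman divergence `f a - f b - ⟪∇f b, a - b⟫`. -/
noncomputable def bregman (f : F → ℝ) (a b : F) : ℝ := f a - f b - ⟪gradient f b, a - b⟫

lemma hasDerivAt_comp_line {f : F → ℝ} (hf : Differentiable ℝ f) (a d : F) (t : ℝ) :
    HasDerivAt (fun s : ℝ => f (a + s • d)) ⟪gradient f (a + t • d), d⟫ t := by
  have h1 : HasDerivAt (fun s : ℝ => a + s • d) d t := by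
    simpa using ((hasDerivAt_id t).smul_const d).const_add a
  have h2 := (hf (a + t • d)).hasGradientAt.hasFDerivAt
  have h3 := h2.comp_hasDerivAt t h1
  rwa [InnerProductSpace.toDual_apply_apply] at h3

lemma le_bregman_of_strongConvexOn {f : F → ℝ} {m : ℝ} (hf : Differentiable ℝ f)
    (hsc : StrongConvexOn Set.univ m f) (a b : F) :
    m / 2 * ‖a - b‖ ^ 2 ≤ bregman f a b := by
  have hconv := strongConvexOn_iff_convex.1 hsc
  have hline : ConvexOn ℝ Set.univ
      (fun s : ℝ => f (b + s • (a - b)) - m / 2 * ‖b + s • (a - b)‖ ^ 2) := by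
    have := hconv.comp_affineMap (AffineMap.lineMap b a : ℝ →ᵃ[ℝ] F)
    simpa [Function.comp_def, AffineMap.lineMap_apply, add_comm] using this
  have hnorm : (fun s : ℝ => m / 2 * ‖b + s • (a - b)‖ ^ 2) = fun s : ℝ =>
      m / 2 * (‖b‖ ^ 2 + 2 * ⟪b, a - b⟫ * s + ‖a - b‖ ^ 2 * s ^ 2) := by
    ext s
    rw [norm_add_sq_real, norm_smul, inner_smul_right, mul_pow, Real.norm_eq_abs, sq_abs]
    ring
  have hder : HasDerivAt (fun s : ℝ => m / 2 * ‖b + s • (a - b)‖ ^ 2)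
      (m / 2 * (2 * ⟪b, a - b⟫)) 0 := by
    rw [hnorm]
    have := ((((hasDerivAt_id (0 : ℝ)).const_mul (2 * ⟪b, a - b⟫)).const_add (‖b‖ ^ 2)).add
      (((hasDerivAt_id (0 : ℝ)).pow 2).const_mul (‖a - b‖ ^ 2))).const_mul (m / 2)
    exact this.congr_deriv (by norm_num)
  have hder' := (hasDerivAt_comp_line hf b (a - b) 0).sub hder
  have h := hline.le_slope_of_hasDerivAt (Set.mem_univ 0) (Set.mem_univ 1) one_pos hder'
  simp only [slope_def_field, zero_smul, add_zero, one_smul, add_sub_cancel, sub_zero,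
    div_one] at h
  have hsq : ‖a‖ ^ 2 = ‖b‖ ^ 2 + 2 * ⟪b, a - b⟫ + ‖a - b‖ ^ 2 := by
    rw [← norm_add_sq_real, add_sub_cancel]
  rw [hsq] at h
  unfold bregman
  linarith

lemma bregman_le_of_lipschitz {f : F → ℝ} {L : ℝ} (hf : Differentiable ℝ f)
    (hlip : ∀ a b, ‖gradient f a - gradient f b‖ ≤ L * ‖a - b‖) (a b : F) :
    bregman f a b ≤ L / 2 * ‖a - b‖ ^ 2 := by
  have hder : ∀ t : ℝ, HasDerivAt
      (fun s : ℝ => f (b + s • (a - b)) - s * ⟪gradient f b, a - b⟫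
        - L / 2 * ‖a - b‖ ^ 2 * s ^ 2)
      (⟪gradient f (b + t • (a - b)), a - b⟫ - ⟪gradient f b, a - b⟫
        - L * ‖a - b‖ ^ 2 * t) t := by
    intro t
    have := ((hasDerivAt_comp_line hf b (a - b) t).sub
      ((hasDerivAt_id t).mul_const ⟪gradient f b, a - b⟫)).sub
      (((hasDerivAt_id t).pow 2).const_mul (L / 2 * ‖a - b‖ ^ 2))
    exact this.congr_deriv (by norm_num; ring)
  have hanti : AntitoneOn (fun s : ℝ => f (b + s • (a - b)) - s * ⟪gradient f b, a - b⟫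
        - L / 2 * ‖a - b‖ ^ 2 * s ^ 2) (Set.Icc 0 1) := by
    refine antitoneOn_of_hasDerivWithinAt_nonpos (convex_Icc 0 1)
      (fun t _ => (hder t).continuousAt.continuousWithinAt)
      (fun t _ => (hder t).hasDerivWithinAt) ?_
    intro t ht
    rw [interior_Icc] at ht
    have h1 := real_inner_le_norm (gradient f (b + t • (a - b)) - gradient f b) (a - b)
    have h2 := hlip (b + t • (a - b)) b
    rw [add_sub_cancel_left, norm_smul, Real.norm_eq_abs, abs_of_pos ht.1] at h2
    rw [inner_sub_left] at h1
    nlinarith [mul_le_mul_of_nonneg_right h2 (norm_nonneg (a - b))]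
  have h := hanti (Set.left_mem_Icc.2 zero_le_one) (Set.right_mem_Icc.2 zero_le_one) zero_le_one
  simp only [one_smul, zero_smul, add_zero, add_sub_cancel] at h
  unfold bregman
  linarith

lemma norm_gradient_sub_sq_le {f : F → ℝ} {L : ℝ} (hL : 0 < L) (hf : Differentiable ℝ f)
    (hconv : ∀ a b, 0 ≤ bregman f a b)
    (hlip : ∀ a b, ‖gradient f a - gradient f b‖ ≤ L * ‖a - b‖) (a b : F) :
    ‖gradient f a - gradient f b‖ ^ 2 ≤ 2 * L * bregman f a b := by
  set r := gradient f a - gradient f b with hr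
  have h1 := hconv (a - L⁻¹ • r) b
  have h2 := bregman_le_of_lipschitz hf hlip (a - L⁻¹ • r) a
  have e1 : a - L⁻¹ • r - b = (a - b) - L⁻¹ • r := by abel
  have e2 : a - L⁻¹ • r - a = -(L⁻¹ • r) := by abel
  unfold bregman at h1 h2 ⊢
  rw [e1, inner_sub_right, inner_smul_right] at h1
  rw [e2, inner_neg_right, inner_smul_right, norm_neg, norm_smul, mul_pow, Real.norm_eq_abs,
    sq_abs] at h2
  have h3 : ⟪gradient f a, r⟫ - ⟪gradient f b, r⟫ = ‖r‖ ^ 2 := by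
    rw [← inner_sub_left, ← hr, real_inner_self_eq_norm_sq]
  have h4 : L⁻¹ * ‖r‖ ^ 2 ≤ f a - f b - ⟪gradient f b, a - b⟫
      + L / 2 * (L⁻¹ ^ 2 * ‖r‖ ^ 2) := by
    linear_combination h1 + h2 - L⁻¹ * h3
  have h5 : L / 2 * (L⁻¹ ^ 2 * ‖r‖ ^ 2) = L⁻¹ * ‖r‖ ^ 2 / 2 := by
    field_simp
  have h6 : L⁻¹ * ‖r‖ ^ 2 ≤ 2 * (f a - f b - ⟪gradient f b, a - b⟫) := by linarith
  rw [inv_mul_le_iff₀ hL] at h6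
  linarith

lemma inner_gradient_sub_eq_bregman_add (f : F → ℝ) (a b : F) :
    ⟪a - b, gradient f a - gradient f b⟫ = bregman f a b + bregman f b a := by
  unfold bregman
  simp only [inner_sub_left, inner_sub_right, real_inner_comm]
  ring

lemma bregman_le_norm_gradient_sub_sq {f : F → ℝ} {m : ℝ} (hm : 0 < m)
    (hsc : ∀ a b, m / 2 * ‖a - b‖ ^ 2 ≤ bregman f a b) (a b : F) :
    2 * m * bregman f a b ≤ ‖gradient f a - gradient f b‖ ^ 2 := by
  have h1 := hsc b a
  have h2 := inner_gradient_sub_eq_bregman_add f a b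
  have h3 := real_inner_le_norm (a - b) (gradient f a - gradient f b)
  rw [norm_sub_rev b a] at h1
  nlinarith [sq_nonneg (m * ‖a - b‖ - ‖gradient f a - gradient f b‖)]

end SmoothConvex

section Average

variable {F : Type*} [NormedAddCommGroup F] [InnerProductSpace ℝ F] [CompleteSpace F]

lemma hasGradientAt_average {q : ℕ} {f : Fin q → F → ℝ} (hf : ∀ i, Differentiable ℝ (f i))
    (w : F) : HasGradientAt (fun w => (q : ℝ)⁻¹ * ∑ i, f i w)
      ((q : ℝ)⁻¹ • ∑ i, gradient (f i) w) w := by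
  rw [hasGradientAt_iff_hasFDerivAt]
  have := (HasFDerivAt.fun_sum (u := Finset.univ) fun i _ =>
    ((hf i) w).hasGradientAt.hasFDerivAt).const_mul (q : ℝ)⁻¹
  simpa using this

lemma bregman_average {q : ℕ} {f : Fin q → F → ℝ} (hf : ∀ i, Differentiable ℝ (f i))
    (a b : F) : bregman (fun w => (q : ℝ)⁻¹ * ∑ i, f i w) a b
      = (q : ℝ)⁻¹ * ∑ i, bregman (f i) a b := by
  unfold bregman
  rw [(hasGradientAt_average hf b).gradient, inner_smul_left, sum_inner]
  simp only [Finset.sum_sub_distrib, conj_trivial]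
  ring

end Average

section FiniteAverage

/-- Second-moment bound for the variance-reduced estimator `r j - (s j - avg s)`. -/
lemma average_norm_sq_saga_le {F : Type*} [NormedAddCommGroup F] [InnerProductSpace ℝ F]
    {q : ℕ} (hq : 0 < q) (r s : Fin q → F) :
    (q : ℝ)⁻¹ * ∑ j, ‖r j - s j + (q : ℝ)⁻¹ • ∑ i, s i‖ ^ 2
      ≤ 2 * ((q : ℝ)⁻¹ * ∑ j, ‖r j‖ ^ 2) + 2 * ((q : ℝ)⁻¹ * ∑ j, ‖s j‖ ^ 2)
        - ‖(q : ℝ)⁻¹ • ∑ i, r i‖ ^ 2 := by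
  have hq' : (q : ℝ) ≠ 0 := by positivity
  have hmean : ∀ t : Fin q → F, ∀ u : F, (q : ℝ)⁻¹ * ∑ j, ⟪t j, u⟫ =
      ⟪(q : ℝ)⁻¹ • ∑ i, t i, u⟫ := by
    intro t u
    rw [inner_smul_left, sum_inner]
    simp
  set R := (q : ℝ)⁻¹ • ∑ i, r i with hR
  set S := (q : ℝ)⁻¹ • ∑ i, s i with hS
  have hpt : ∀ j, ‖r j - s j + S‖ ^ 2 ≤ 2 * ‖r j‖ ^ 2 + 2 * ‖s j‖ ^ 2
      + (‖R‖ ^ 2 + 2 * ‖S‖ ^ 2 + 2 * ⟪S, R⟫)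
      - 2 * ⟪r j, R⟫ - 2 * ⟪s j, R⟫ - 4 * ⟪s j, S⟫ := by
    intro j
    have h := real_inner_self_nonneg (x := (r j - R) + (s j - S))
    simp only [← real_inner_self_eq_norm_sq, inner_add_left, inner_sub_left, inner_add_right,
      inner_sub_right] at h ⊢
    rw [real_inner_comm (r j) R, real_inner_comm (s j) R, real_inner_comm S R,
      real_inner_comm (s j) S, real_inner_comm (r j) S, real_inner_comm (s j) (r j)] at *
    linarith
  have hsum := mul_le_mul_of_nonneg_left (Finset.sum_le_sum fun j (_ : j ∈ Finset.univ) => hpt j)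
    (inv_nonneg.2 (Nat.cast_nonneg q))
  simp only [Finset.sum_sub_distrib, Finset.sum_add_distrib, ← Finset.mul_sum, mul_sub, mul_add,
    mul_left_comm (q : ℝ)⁻¹, hmean] at hsum
  have hconst : ∀ k : ℝ, (q : ℝ)⁻¹ * ∑ _j : Fin q, k = k := fun k => by simp [hq']
  have hconst' : (q : ℝ)⁻¹ • ∑ _j : Fin q, S = S := by
    simp [← Nat.cast_smul_eq_nsmul ℝ, smul_smul, hq']
  rw [← hR, ← hS, hconst, hconst, hconst', real_inner_self_eq_norm_sq,
    real_inner_self_eq_norm_sq] at hsum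
  nlinarith [sq_nonneg ‖S‖]

lemma average_inner_saga {F : Type*} [NormedAddCommGroup F] [InnerProductSpace ℝ F]
    {q : ℕ} (hq : 0 < q) (a b : Fin q → F) (e gs : F) :
    (q : ℝ)⁻¹ * ∑ j, ⟪e, a j - b j + (q : ℝ)⁻¹ • ∑ i, b i - gs⟫
      = ⟪e, (q : ℝ)⁻¹ • ∑ j, a j - gs⟫ := by
  have hq' : (q : ℝ) ≠ 0 := by positivity
  simp only [inner_add_right, inner_sub_right, Finset.sum_add_distrib, Finset.sum_sub_distrib,
    inner_smul_right, inner_sum, Finset.sum_const, Finset.card_univ, Fintype.card_fin,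
    nsmul_eq_mul]
  field_simp
  ring

lemma average_apply {N q : ℕ} (hq : 0 < q) (n : Fin N) (φ : Fin q → ℝ) :
    ((q : ℝ) ^ N)⁻¹ * ∑ i : Fin N → Fin q, φ (i n) = (q : ℝ)⁻¹ * ∑ j, φ j := by
  have h := Fintype.sum_piFinset_apply φ Finset.univ n
  rw [Fintype.piFinset_univ] at h
  rw [h]
  obtain ⟨k, rfl⟩ : ∃ k, N = k + 1 := ⟨N - 1, by have := n.pos; omega⟩
  have hq' : (q : ℝ) ≠ 0 := by positivity
  simp only [Finset.card_univ, Fintype.card_fin, nsmul_eq_mul, Nat.cast_pow]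
  rw [Nat.add_sub_cancel]
  field_simp
  ring

lemma average_sum_apply {N q : ℕ} (hq : 0 < q) (φ : Fin N → Fin q → ℝ) :
    ((q : ℝ) ^ N)⁻¹ * ∑ i : Fin N → Fin q, ∑ n, φ n (i n) = ∑ n, (q : ℝ)⁻¹ * ∑ j, φ n j := by
  rw [Finset.sum_comm, Finset.mul_sum]
  exact Finset.sum_congr rfl fun n _ => average_apply hq n (φ n)

/-- Expectation of a table sum after one uniformly random entry is replaced. -/
lemma average_sum_update {X : Type*} {q : ℕ} (hq : 0 < q) (φ : Fin q → X → ℝ)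
    (y : Fin q → X) (x : X) :
    (q : ℝ)⁻¹ * ∑ j, ((q : ℝ)⁻¹ * ∑ i, φ i (Function.update y j x i))
      = (1 - (q : ℝ)⁻¹) * ((q : ℝ)⁻¹ * ∑ i, φ i (y i))
        + (q : ℝ)⁻¹ * ((q : ℝ)⁻¹ * ∑ i, φ i x) := by
  have hq' : (q : ℝ) ≠ 0 := by positivity
  have hj : ∀ j, ∑ i, φ i (Function.update y j x i)
      = ∑ i, φ i (y i) + (φ j x - φ j (y j)) := by
    intro j
    have h : ∀ i, φ i (Function.update y j x i)
        = φ i (y i) + if i = j then φ i x - φ i (y i) else 0 := by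
      intro i
      by_cases hij : i = j
      · subst hij; simp
      · simp [hij]
    simp [h, Finset.sum_add_distrib]
  simp only [hj, mul_add, Finset.sum_add_distrib, ← Finset.mul_sum, Finset.sum_sub_distrib,
    Finset.sum_const, Finset.card_univ, Fintype.card_fin, nsmul_eq_mul]
  field_simp
  ring

end FiniteAverage

section Operator

variable {E : Type*} [NormedAddCommGroup E] [InnerProductSpace ℝ E]

lemma norm_apply_sq_le_of_le {A : E →ₗ[ℝ] E} (hA : A.IsSymmetric) {Γ : ℝ} (hΓ0 : 0 < Γ)
    (hpos : ∀ w, 0 ≤ ⟪w, A w⟫) (hΓ : ∀ w, ⟪w, A w⟫ ≤ Γ * ‖w‖ ^ 2) (w : E) :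
    ‖A w‖ ^ 2 ≤ Γ * ⟪w, A w⟫ := by
  have h1 := hpos (Γ • w - A w)
  have h2 := hΓ (A w)
  have h3 : ⟪w, A (A w)⟫ = ‖A w‖ ^ 2 := by
    rw [← hA w (A w), real_inner_self_eq_norm_sq]
  simp only [map_sub, map_smul, inner_sub_left, inner_sub_right, inner_smul_left,
    inner_smul_right, conj_trivial, h3, real_inner_self_eq_norm_sq] at h1
  exact le_of_mul_le_mul_left (by nlinarith : Γ * ‖A w‖ ^ 2 ≤ Γ * (Γ * ⟪w, A w⟫)) hΓ0

lemma exists_apply_apply_eq [FiniteDimensional ℝ E] {U : E →ₗ[ℝ] E} (hU : U.IsSymmetric)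
    (a : E) : ∃ b, U (U b) = U a := by
  have hker : LinearMap.ker (U ∘ₗ U) = LinearMap.ker U := by
    ext w
    simp only [LinearMap.mem_ker, LinearMap.comp_apply]
    refine ⟨fun h => ?_, fun h => by rw [h, map_zero]⟩
    rw [← inner_self_eq_zero (𝕜 := ℝ), hU, h, inner_zero_right]
  have hU2 : (U ∘ₗ U).IsSymmetric := fun x y => by
    simp only [LinearMap.comp_apply]
    rw [hU, hU]
  have hrange : LinearMap.range (U ∘ₗ U) = LinearMap.range U := by
    rw [← Submodule.orthogonal_orthogonal (LinearMap.range (U ∘ₗ U)), hU2.orthogonal_range, hker,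
      ← hU.orthogonal_range, Submodule.orthogonal_orthogonal]
  have : U a ∈ LinearMap.range (U ∘ₗ U) := hrange ▸ LinearMap.mem_range_self U a
  simpa using this

/-- One primal-dual step in error coordinates: `e`, `w` are the current primal and dual errors,
`r` is the error of the gradient estimate. -/
lemma primal_dual_step_le {A U : E →ₗ[ℝ] E} (hA : A.IsSymmetric) (hU : U.IsSymmetric)
    (hUU : ∀ w, U (U w) = w - A w) {γ Γ γ' α η δ : ℝ} (hγ0 : 0 < γ) (hΓ0 : 0 < Γ)
    (hγ'0 : 0 < γ') (hη : 0 < η) (hα : 0 < α) (hδ : 0 ≤ δ)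
    (hγ : ∀ w, γ * ‖w‖ ^ 2 ≤ ⟪w, A w⟫) (hΓ : ∀ w, ⟪w, A w⟫ ≤ Γ * ‖w‖ ^ 2)
    (hγ' : ∀ a, γ' * ‖U a‖ ^ 2 ≤ ‖U (U a)‖ ^ 2)
    (hαη : 4 * (α * η) = γ) (hδ2 : 2 * δ ≤ 1) (hδΓ : 16 * (δ * Γ) ≤ γ')
    {e r w d : E} (hw : ∃ b, w = U b) (hd : d = A e - α • r - U w) :
    ⟪d, A d⟫ + ‖w + U d‖ ^ 2 ≤ (1 - δ) * (⟪e, A e⟫ + ‖w‖ ^ 2) - 2 * α * ⟪e, r⟫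
      + (α / η + δ * (4 * α ^ 2 / γ')) * ‖r‖ ^ 2 + δ * (Γ * ‖e‖ ^ 2) := by
  obtain ⟨b, hb⟩ := hw
  have hpos : ∀ w, 0 ≤ ⟪w, A w⟫ := fun w => le_trans (by positivity) (hγ w)
  set z := e - d with hz
  have hUw : U w = A e - α • r - d := by rw [hd]; abel
  have hUd : ‖U d‖ ^ 2 = ‖d‖ ^ 2 - ⟪d, A d⟫ := by
    rw [← real_inner_self_eq_norm_sq, hU, hUU, inner_sub_right, real_inner_self_eq_norm_sq]
  have hexpand : ‖w + U d‖ ^ 2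
      = ‖w‖ ^ 2 + 2 * (⟪e, A d⟫ - α * ⟪d, r⟫ - ‖d‖ ^ 2) + ‖U d‖ ^ 2 := by
    rw [norm_add_sq_real, ← hU, hUw, inner_sub_left, inner_sub_left, inner_smul_left, hA,
      real_inner_self_eq_norm_sq, real_inner_comm d r, conj_trivial]
  have hzA : ⟪z, A z⟫ = ⟪e, A e⟫ - 2 * ⟪e, A d⟫ + ⟪d, A d⟫ := by
    have : ⟪d, A e⟫ = ⟪e, A d⟫ := by rw [← hA, real_inner_comm]
    rw [hz, map_sub, inner_sub_left, inner_sub_right, inner_sub_right, this]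
    ring
  have hyoung : -(α * η * ‖z‖ ^ 2 + α / η * ‖r‖ ^ 2) ≤ 2 * α * (⟪d, r⟫ - ⟪e, r⟫) := by
    have h := real_inner_le_norm z r
    rw [hz, inner_sub_left, ← hz] at h
    have h2 : 2 * (‖z‖ * ‖r‖) ≤ η * ‖z‖ ^ 2 + ‖r‖ ^ 2 / η := by
      have h3 : η * ‖z‖ ^ 2 + ‖r‖ ^ 2 / η - 2 * (‖z‖ * ‖r‖) = (η * ‖z‖ - ‖r‖) ^ 2 / η := by
        field_simp
        ring
      have : 0 ≤ (η * ‖z‖ - ‖r‖) ^ 2 / η := by positivity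
      linarith
    have h4 := mul_le_mul_of_nonneg_left (h2.trans' (mul_le_mul_of_nonneg_left h two_pos.le)) hα.le
    have h5 : α * (η * ‖z‖ ^ 2 + ‖r‖ ^ 2 / η) = α * η * ‖z‖ ^ 2 + α / η * ‖r‖ ^ 2 := by ring
    linarith
  have hdual : γ' * ‖w‖ ^ 2 ≤ 4 * Γ * ⟪z, A z⟫ + 4 * α ^ 2 * ‖r‖ ^ 2 + 2 * γ' * ‖U d‖ ^ 2 := by
    have h1 := hγ' (b + d)
    rw [map_add, ← hb] at h1
    have h2 : U (w + U d) = A z - α • r := by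
      rw [map_add, hUw, hUU, hz, map_sub]; abel
    rw [h2] at h1
    have h3 := norm_apply_sq_le_of_le hA hΓ0 hpos hΓ z
    have h4 := parallelogram_law_with_norm ℝ (A z) (α • r)
    have h5 := parallelogram_law_with_norm ℝ (w + U d) (U d)
    rw [add_sub_cancel_right] at h5
    have h6 : ‖α • r‖ ^ 2 = α ^ 2 * ‖r‖ ^ 2 := by
      rw [norm_smul, mul_pow, Real.norm_eq_abs, sq_abs]
    have h7 : ‖w‖ ^ 2 ≤ 2 * ‖w + U d‖ ^ 2 + 2 * ‖U d‖ ^ 2 := by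
      nlinarith [mul_self_nonneg ‖w + U d + U d‖]
    have h8 : ‖A z - α • r‖ ^ 2 ≤ 2 * ‖A z‖ ^ 2 + 2 * ‖α • r‖ ^ 2 := by
      nlinarith [mul_self_nonneg ‖A z + α • r‖]
    have h9 := mul_le_mul_of_nonneg_left h7 hγ'0.le
    linarith
  have hdual' : δ * ‖w‖ ^ 2 ≤ 4⁻¹ * ⟪z, A z⟫ + δ * (4 * α ^ 2 / γ') * ‖r‖ ^ 2 + ‖U d‖ ^ 2 := by
    have h1 : ‖w‖ ^ 2 ≤
        (4 * Γ * ⟪z, A z⟫ + 4 * α ^ 2 * ‖r‖ ^ 2 + 2 * γ' * ‖U d‖ ^ 2) / γ' := by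
      rw [le_div_iff₀ hγ'0]; linarith
    have h2 := mul_le_mul_of_nonneg_left h1 hδ
    have h3 : δ * ((4 * Γ * ⟪z, A z⟫ + 4 * α ^ 2 * ‖r‖ ^ 2 + 2 * γ' * ‖U d‖ ^ 2) / γ')
        = 4 * (δ * Γ / γ') * ⟪z, A z⟫ + δ * (4 * α ^ 2 / γ') * ‖r‖ ^ 2
          + 2 * δ * ‖U d‖ ^ 2 := by
      field_simp
    have h4 : δ * Γ / γ' ≤ 16⁻¹ := by
      rw [div_le_iff₀ hγ'0]; linarith
    have h5 := mul_le_mul_of_nonneg_right h4 (hpos z)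
    have h6 := mul_le_mul_of_nonneg_right hδ2 (sq_nonneg ‖U d‖)
    linarith
  have h1 := hγ z
  have h2 := mul_le_mul_of_nonneg_left (hΓ e) hδ
  have h3 := hpos z
  rw [← hαη] at h1
  nlinarith

end Operator

section Node

variable {F : Type*} [NormedAddCommGroup F] [InnerProductSpace ℝ F] [CompleteSpace F]

/-- Mean-square error of the local stochastic averaging gradient. -/
lemma average_norm_sq_saga_le_bregman {q : ℕ} (hq : 0 < q) {μ L : ℝ} (hμ : 0 < μ) (hL : 0 < L)
    {f : Fin q → F → ℝ} (hf : ∀ i, Differentiable ℝ (f i))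
    (hsc : ∀ i, StrongConvexOn Set.univ μ (f i))
    (hlip : ∀ i a b, ‖gradient (f i) a - gradient (f i) b‖ ≤ L * ‖a - b‖)
    (x xs : F) (y : Fin q → F) :
    (q : ℝ)⁻¹ * ∑ j, ‖gradient (f j) x - gradient (f j) (y j)
        + (q : ℝ)⁻¹ • ∑ i, gradient (f i) (y i)
        - gradient (fun w => (q : ℝ)⁻¹ * ∑ i, f i w) xs‖ ^ 2
      ≤ 4 * L * ((q : ℝ)⁻¹ * ∑ i, bregman (f i) (y i) xs)
        + (4 * L - 2 * μ) * bregman (fun w => (q : ℝ)⁻¹ * ∑ i, f i w) x xs := by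
  have hq' : (q : ℝ) ≠ 0 := by positivity
  set f' : F → ℝ := fun w => (q : ℝ)⁻¹ * ∑ i, f i w with hf'
  have hgrad : ∀ w, gradient f' w = (q : ℝ)⁻¹ • ∑ i, gradient (f i) w :=
    fun w => (hasGradientAt_average hf w).gradient
  have hbreg : ∀ a b, bregman f' a b = (q : ℝ)⁻¹ * ∑ i, bregman (f i) a b :=
    bregman_average hf
  have hscf : ∀ a b, μ / 2 * ‖a - b‖ ^ 2 ≤ bregman f' a b := by
    intro a b
    have h := Finset.sum_le_sum fun i (_ : i ∈ Finset.univ) =>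
      le_bregman_of_strongConvexOn (hf i) (hsc i) a b
    rw [Finset.sum_const, Finset.card_univ, Fintype.card_fin, nsmul_eq_mul] at h
    rw [hbreg, le_inv_mul_iff₀ (by positivity)]
    exact h
  have hcoc : ∀ i a b, ‖gradient (f i) a - gradient (f i) b‖ ^ 2 ≤ 2 * L * bregman (f i) a b :=
    fun i => norm_gradient_sub_sq_le hL (hf i)
      (fun a b => (by positivity : (0 : ℝ) ≤ μ / 2 * ‖a - b‖ ^ 2).trans
        (le_bregman_of_strongConvexOn (hf i) (hsc i) a b)) (hlip i)
  have hvar := average_norm_sq_saga_le hq (fun i => gradient (f i) x - gradient (f i) xs)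
    (fun i => gradient (f i) (y i) - gradient (f i) xs)
  have hmean : (q : ℝ)⁻¹ • ∑ i, (gradient (f i) x - gradient (f i) xs)
      = gradient f' x - gradient f' xs := by
    rw [hgrad, hgrad, Finset.sum_sub_distrib, smul_sub]
  have hest : ∀ j, gradient (f j) x - gradient (f j) xs
      - (gradient (f j) (y j) - gradient (f j) xs)
      + (q : ℝ)⁻¹ • ∑ i, (gradient (f i) (y i) - gradient (f i) xs)
      = gradient (f j) x - gradient (f j) (y j)
        + (q : ℝ)⁻¹ • ∑ i, gradient (f i) (y i) - gradient f' xs := by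
    intro j
    rw [hgrad, Finset.sum_sub_distrib, smul_sub]
    abel
  simp only [hest, hmean] at hvar
  have h1 := Finset.sum_le_sum fun i (_ : i ∈ Finset.univ) => hcoc i x xs
  have h2 := Finset.sum_le_sum fun i (_ : i ∈ Finset.univ) => hcoc i (y i) xs
  rw [← Finset.mul_sum] at h1 h2
  have h1' := mul_le_mul_of_nonneg_left h1 (inv_nonneg.2 (Nat.cast_nonneg (α := ℝ) q))
  have h2' := mul_le_mul_of_nonneg_left h2 (inv_nonneg.2 (Nat.cast_nonneg (α := ℝ) q))
  rw [mul_left_comm] at h1' h2'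
  rw [← hbreg] at h1'
  have h3 := bregman_le_norm_gradient_sub_sq hμ hscf x xs
  linarith

end Node

section Block

variable {N p : ℕ}

/-- The Hilbert space `ℝ^{Np}` of block vectors. -/
abbrev BlockSpace (N p : ℕ) := PiLp 2 (fun _ : Fin N => Evec p)

/-- The operator `M ⊗ I_p`. -/
noncomputable def blockMap (M : Matrix (Fin N) (Fin N) ℝ) : BlockSpace N p →ₗ[ℝ] BlockSpace N p where
  toFun a := WithLp.toLp 2 fun n => ∑ m, M n m • a m
  map_add' a b := by
    ext1 n
    simp [Finset.sum_add_distrib]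
  map_smul' c a := by
    ext1 n
    simp [Finset.smul_sum, smul_comm c]

@[simp] lemma blockMap_apply (M : Matrix (Fin N) (Fin N) ℝ) (a : BlockSpace N p) (n : Fin N) :
    blockMap M a n = ∑ m, M n m • a m := rfl

lemma inner_blockMap (M : Matrix (Fin N) (Fin N) ℝ) (a : BlockSpace N p) :
    ⟪a, blockMap M a⟫ = quadForm M a := by
  rw [PiLp.inner_apply]; rfl

lemma norm_sq_eq_sqnormB (a : BlockSpace N p) : ‖a‖ ^ 2 = sqnormB a :=
  PiLp.norm_sq_eq_of_L2 _ a

lemma blockMap_isSymmetric {M : Matrix (Fin N) (Fin N) ℝ} (hM : M.IsSymm) :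
    (blockMap (p := p) M).IsSymmetric := by
  intro a b
  simp only [PiLp.inner_apply, blockMap_apply, sum_inner, inner_sum, inner_smul_left,
    inner_smul_right, conj_trivial]
  rw [Finset.sum_comm]
  exact Finset.sum_congr rfl fun n _ => Finset.sum_congr rfl fun m _ => by rw [hM.apply]

lemma blockMap_mul (M M' : Matrix (Fin N) (Fin N) ℝ) (a : BlockSpace N p) :
    blockMap (M * M') a = blockMap M (blockMap M' a) := by
  ext1 n
  simp only [blockMap_apply, Matrix.mul_apply, Finset.sum_smul, Finset.smul_sum, smul_smul]
  exact Finset.sum_comm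

lemma blockMap_one_sub (M : Matrix (Fin N) (Fin N) ℝ) (a : BlockSpace N p) :
    blockMap (1 - M) a = a - blockMap M a := by
  ext1 n
  simp [sub_smul, Finset.sum_sub_distrib, Matrix.one_apply]

lemma blockMap_const {M : Matrix (Fin N) (Fin N) ℝ} (hM : M.mulVec (fun _ => 1) = 0)
    (w : Evec p) : blockMap M (WithLp.toLp 2 fun _ => w) = 0 := by
  ext1 n
  have h := congrFun hM n
  simp only [Matrix.mulVec, dotProduct, mul_one, Pi.zero_apply] at h
  simp [← Finset.sum_smul, h]

lemma quadForm_pos_of_posDef {M : Matrix (Fin N) (Fin N) ℝ} (hM : M.PosDef)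
    {a : Fin N → Evec p} (ha : a ≠ 0) : 0 < quadForm M a := by
  have hk : quadForm M a = ∑ k, (fun n => a n k) ⬝ᵥ M.mulVec (fun n => a n k) := by
    simp only [quadForm, PiLp.inner_apply, dotProduct, Matrix.mulVec]
    rw [Finset.sum_comm]
    refine Finset.sum_congr rfl fun k _ => Finset.sum_congr rfl fun n _ => ?_
    simp [mul_comm]
  obtain ⟨n, hn⟩ := Function.ne_iff.1 ha
  obtain ⟨k, hnk⟩ : ∃ k, a n k ≠ 0 := by
    by_contra! h
    exact hn (PiLp.ext h)
  rw [hk]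
  refine Finset.sum_pos' (fun k _ => ?_) ⟨k, Finset.mem_univ k, ?_⟩
  · simpa using hM.posSemidef.dotProduct_mulVec_nonneg (fun n => a n k)
  · simpa using hM.dotProduct_mulVec_pos (x := fun n => a n k) fun h => hnk (congrFun h n)

end Block

section Constants

variable {μ L γ Γ γ' Γ' κg δ q : ℝ}

/-- Consequences of the explicit choice of `δ`, in the form used by the contraction argument. -/
lemma contraction_factor_bounds (hμ : 0 < μ) (hμL : μ ≤ L) (hγ : 0 < γ) (hγΓ : γ ≤ Γ)
    (hγ' : 0 < γ') (hq : 1 ≤ q) (hκg : κg = max Γ Γ' / min γ γ')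
    (hδ : δ = min (1 / (16 * κg ^ 2))
      (min (1 / (q * (1 + 4 * (L / μ) * (1 + γ / γ'))))
        (1 / (4 * (γ / γ') * (L / μ) + 32 * κg * (L / μ) ^ 4)))) :
    0 < δ ∧ 2 * δ ≤ 1 ∧ 16 * (δ * Γ) ≤ γ'
      ∧ δ * (γ / γ' + q * (1 + μ / (4 * L))) ≤ μ / (4 * L)
      ∧ δ * (γ * μ ^ 2 / (4 * L ^ 3) * (γ / γ') + 2 * Γ / μ)
        ≤ γ * μ ^ 2 / (4 * L ^ 3) * (μ / (4 * L)) := by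
  have hL : 0 < L := hμ.trans_le hμL
  have hΓ : 0 < Γ := hγ.trans_le hγΓ
  have hmin : 0 < min γ γ' := lt_min hγ hγ'
  have hκγ : Γ / γ ≤ κg := by
    rw [hκg]; gcongr
    · exact le_max_left _ _
    · exact min_le_left _ _
  have hκγ' : Γ / γ' ≤ κg := by
    rw [hκg]; gcongr
    · exact le_max_left _ _
    · exact min_le_right _ _
  have hκ1 : 1 ≤ κg := ((one_le_div hγ).2 hγΓ).trans hκγ
  have hκ0 : 0 < κg := by linarith
  have hδ0 : 0 < δ := by
    rw [hδ]
    refine lt_min (by positivity) (lt_min ?_ ?_) <;> positivity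
  have h1 : δ * (16 * κg ^ 2) ≤ 1 :=
    (le_div_iff₀ (by positivity)).1 (hδ.le.trans (min_le_left _ _))
  have h2 : δ * (q * (1 + 4 * (L / μ) * (1 + γ / γ'))) ≤ 1 :=
    (le_div_iff₀ (by positivity)).1
      (hδ.le.trans ((min_le_right _ _).trans (min_le_left _ _)))
  have h3 : δ * (4 * (γ / γ') * (L / μ) + 32 * κg * (L / μ) ^ 4) ≤ 1 :=
    (le_div_iff₀ (by positivity)).1
      (hδ.le.trans ((min_le_right _ _).trans (min_le_right _ _)))
  have h16 : δ * (16 * κg) ≤ 1 := by nlinarith [mul_pos hδ0 hκ0]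
  refine ⟨hδ0, by nlinarith, ?_, ?_, ?_⟩
  · have h4 : Γ ≤ κg * γ' := (div_le_iff₀ hγ').1 hκγ'
    have h5 := mul_le_mul_of_nonneg_left h4 hδ0.le
    nlinarith
  · have h4 : γ / γ' ≤ q * (γ / γ') := le_mul_of_one_le_left (by positivity) hq
    have h5 := mul_le_mul_of_nonneg_left h2 (by positivity : 0 ≤ μ / (4 * L))
    have h6 : μ / (4 * L) * (δ * (q * (1 + 4 * (L / μ) * (1 + γ / γ'))))
        = δ * (q * (γ / γ') + q * (1 + μ / (4 * L))) := by
      field_simp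
      ring
    have h7 := mul_le_mul_of_nonneg_left h4 hδ0.le
    linarith
  · have h4 : 4 * (γ / γ') * (L / μ) + 32 * (Γ / γ) * (L / μ) ^ 4
        ≤ 4 * (γ / γ') * (L / μ) + 32 * κg * (L / μ) ^ 4 := by gcongr
    have h5 := (mul_le_mul_of_nonneg_left h4 hδ0.le).trans h3
    have h6 := mul_le_mul_of_nonneg_left h5
      (by positivity : 0 ≤ γ * μ ^ 2 / (4 * L ^ 3) * (μ / (4 * L)))
    have h7 : γ * μ ^ 2 / (4 * L ^ 3) * (μ / (4 * L))
        * (δ * (4 * (γ / γ') * (L / μ) + 32 * (Γ / γ) * (L / μ) ^ 4))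
        = δ * (γ * μ ^ 2 / (4 * L ^ 3) * (γ / γ') + 2 * Γ / μ) := by
      field_simp
      ring
    linarith

/-- The averaged error terms are absorbed by the decrease of the gradient-table potential. -/
lemma averaged_error_le {η α c D G H R T : ℝ} (hμ : 0 < μ) (hμL : μ ≤ L) (hγ : 0 < γ)
    (hΓ : 0 < Γ) (hγ' : 0 < γ') (hq : 0 < q) (hη : η = 2 * L ^ 2 / μ)
    (hα : α = γ * μ / (8 * L ^ 2))
    (hc : c = q * γ * μ ^ 2 / (4 * L ^ 3) * (1 + μ / (4 * L))) (hδ : 0 < δ)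
    (h1 : δ * (γ / γ' + q * (1 + μ / (4 * L))) ≤ μ / (4 * L))
    (h2 : δ * (γ * μ ^ 2 / (4 * L ^ 3) * (γ / γ') + 2 * Γ / μ)
        ≤ γ * μ ^ 2 / (4 * L ^ 3) * (μ / (4 * L)))
    (hD : μ * R ≤ D) (hH : H ≤ 4 * L * T + (4 * L - 2 * μ) * G)
    (hG : μ / 2 * R ≤ G) (hG' : G ≤ L / 2 * R) (hR : 0 ≤ R) (hT : 0 ≤ T) :
    -(2 * α * D) + (α / η + δ * (4 * α ^ 2 / γ')) * H + δ * (Γ * R)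
      + c * ((1 - q⁻¹) * T + q⁻¹ * G) ≤ (1 - δ) * (c * T) := by
  have hL : 0 < L := hμ.trans_le hμL
  set ρ := γ / γ' with hρ
  set ε := μ / (4 * L) with hε
  set P := γ * μ ^ 2 / (4 * L ^ 3) with hP
  have hP0 : 0 < P := by positivity
  have hρ0 : 0 < ρ := by positivity
  have hε0 : 0 < ε := by positivity
  have hG0 : 0 ≤ G := le_trans (by positivity) hG
  have hα0 : 0 < α := by rw [hα]; positivity
  have hαμ : 2 * α * μ = P * L := by rw [hα, hP]; field_simp; norm_num
  have hcoef : α / η + δ * (4 * α ^ 2 / γ') = (1 + δ * ρ) * P / (4 * L) := by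
    rw [hα, hη, hP, hρ]; field_simp; ring
  have hc' : c = q * P * (1 + ε) := by rw [hc, hP]; ring
  have e1 : 2 * P * G ≤ 2 * α * D := by
    have h := mul_le_mul_of_nonneg_left hD (by positivity : 0 ≤ 2 * α)
    rw [← mul_assoc, hαμ] at h
    nlinarith
  have e2 : (1 + δ * ρ) * P / (4 * L) * H ≤ (1 + δ * ρ) * P * (T + (1 - 2 * ε) * G) := by
    have h := mul_le_mul_of_nonneg_left hH
      (by positivity : 0 ≤ (1 + δ * ρ) * P / (4 * L))
    have h' : (1 + δ * ρ) * P / (4 * L) * (4 * L * T + (4 * L - 2 * μ) * G)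
        = (1 + δ * ρ) * P * (T + (1 - 2 * ε) * G) := by
      rw [hε]; field_simp
    linarith
  have e3 : δ * (Γ * R) ≤ δ * (2 * Γ / μ) * G := by
    have h : δ * (2 * Γ / μ) * (μ / 2 * R) = δ * (Γ * R) := by field_simp
    rw [← h]; gcongr
  have e4 : c * ((1 - q⁻¹) * T + q⁻¹ * G) = c * T + P * (1 + ε) * (G - T) := by
    rw [hc']; field_simp; ring
  have e5 := mul_le_mul_of_nonneg_right h1 (by positivity : 0 ≤ P * T)
  have e6 := mul_le_mul_of_nonneg_right h2 hG0
  have e7 : 0 ≤ δ * ρ * P * (2 * ε) * G := by positivity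
  rw [hcoef, e4, hc']
  linarith

end Constants

end DSA

/-- **Corollary 8 of the DSA paper (explicit convergence constant).**
In the setting of Theorem 5 with `W̃ = (I+W)/2` and the same number `q` of
instantaneous functions at every node, the choices `η = 2L²/μ`,
`α = γμ/(8L²)`, `c = (qγμ²/(4L³))(1 + μ/(4L))` satisfy the interval conditions of
Theorem 5 and the one-step contraction holds with the explicit constant
`δ = min{ 1/(16κ_g²), 1/(q[1 + 4κ_f(1 + γ/γ')]), 1/(4(γ/γ')κ_f + 32κ_g κ_f⁴) }`,
where `κ_f = L/μ`, `κ_g = max{Γ,Γ'}/min{γ,γ'}`, `γ, Γ` are the smallest and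
largest eigenvalues of `Z̃` and `γ', Γ'` the smallest nonzero and largest
eigenvalues of `Z̃ − Z` (characterized by their extremal quadratic-form
properties). -/
theorem dsa_corollary8_explicit_constant
    {N p : ℕ} {qc : ℕ} (hqc : 0 < qc)
    (μ L : ℝ) (hμ : 0 < μ) (hμL : μ ≤ L)
    (f : Fin N → Fin qc → Evec p → ℝ)
    (hdiff : ∀ n i, Differentiable ℝ (f n i))
    (hsc : ∀ n i, StrongConvexOn Set.univ μ (f n i))
    (hlip : ∀ n i a b, ‖gradient (f n i) a - gradient (f n i) b‖ ≤ L * ‖a - b‖)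
    (W Wt Us : Matrix (Fin N) (Fin N) ℝ)
    (hWtdef : Wt = (2:ℝ)⁻¹ • ((1 : Matrix (Fin N) (Fin N) ℝ) + W))
    (hWsym : W.IsSymm) (hWtsym : Wt.IsSymm)
    (hnullW : ∀ v : Fin N → ℝ,
      ((1 : Matrix (Fin N) (Fin N) ℝ) - W).mulVec v = 0 ↔ ∃ c : ℝ, v = fun _ => c)
    (hnulldiff : ∀ v : Fin N → ℝ, (Wt - W).mulVec v = 0 ↔ ∃ c : ℝ, v = fun _ => c)
    (hnullWt : ((1 : Matrix (Fin N) (Fin N) ℝ) - Wt).mulVec (fun _ => (1:ℝ)) = 0)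
    (hord1 : (Wt - W).PosSemidef)
    (hord2 : ((1 : Matrix (Fin N) (Fin N) ℝ) + W - (2:ℝ) • Wt).PosSemidef)
    (hWtpos : Wt.PosDef)
    (hUs : Us.PosSemidef) (hUs2 : Us * Us = Wt - W)
    (γ Γ γ' Γ' : ℝ)
    (hγ : ∀ w : Fin N → Evec p, γ * sqnormB w ≤ quadForm Wt w)
    (hγach : ∃ w : Fin N → Evec p, w ≠ 0 ∧ quadForm Wt w = γ * sqnormB w)
    (hΓ : ∀ w : Fin N → Evec p, quadForm Wt w ≤ Γ * sqnormB w)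
    (hΓach : ∃ w : Fin N → Evec p, w ≠ 0 ∧ quadForm Wt w = Γ * sqnormB w)
    (hγ'pos : 0 < γ')
    (hγ' : ∀ w : Fin N → Evec p,
      (∃ a : Fin N → Evec p, ∀ n, w n = ∑ m, (Wt - W) n m • a m) →
        γ' * sqnormB w ≤ quadForm (Wt - W) w)
    (hγ'ach : ∃ w : Fin N → Evec p, w ≠ 0 ∧
      (∃ a : Fin N → Evec p, ∀ n, w n = ∑ m, (Wt - W) n m • a m) ∧
      quadForm (Wt - W) w = γ' * sqnormB w)
    (hΓ' : ∀ w : Fin N → Evec p, quadForm (Wt - W) w ≤ Γ' * sqnormB w)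
    (hΓ'ach : ∃ w : Fin N → Evec p, w ≠ 0 ∧ quadForm (Wt - W) w = Γ' * sqnormB w)
    (η α c κf κg δ : ℝ)
    (hηdef : η = 2 * L^2 / μ)
    (hαdef : α = γ * μ / (8 * L^2))
    (hcdef : c = qc * γ * μ^2 / (4 * L^3) * (1 + μ / (4 * L)))
    (hκf : κf = L / μ)
    (hκg : κg = max Γ Γ' / min γ γ')
    (hδdef : δ = min (1 / (16 * κg^2))
        (min (1 / (qc * (1 + 4 * κf * (1 + γ / γ'))))
             (1 / (4 * (γ / γ') * κf + 32 * κg * κf^4))))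
    (xstar : Evec p)
    (hxstar : ∀ w, ∑ n, locf f n xstar ≤ ∑ n, locf f n w)
    (vstar : Fin N → Evec p)
    (hvstar : ∀ n, α • gradient (locf f n) xstar + ∑ m, Us n m • vstar m = 0)
    (hvstarcol : ∃ a : Fin N → Evec p, ∀ n, vstar n = ∑ m, Us n m • a m) :
    -- the chosen η, α, c satisfy the interval conditions of Theorem 5
    (L^2 * qc / (μ * qc) + L^2 / μ - L < η)
    ∧ (0 < α ∧ α < γ / (2 * η))
    ∧ (4 * α * L * qc / η < c ∧ c < 4 * α * μ * qc / L - 2 * α * qc * (2 * L - μ) / η)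
    -- and the one-step contraction of Theorem 5 holds with the explicit δ
    ∧ (0 < δ ∧ δ < 1)
    ∧ (∀ (x v : Fin N → Evec p) (y : Fin N → Fin qc → Evec p),
        (∃ a : Fin N → Evec p, ∀ n, v n = ∑ m, Us n m • a m) →
        ∀ (xp vp : (Fin N → Fin qc) → Fin N → Evec p),
          (∀ i n, xp i n = x n - α • hatg f x y n (i n)
              - (x n - ∑ m, Wt n m • x m) - ∑ m, Us n m • v m) →
          (∀ i n, vp i n = v n + ∑ m, Us n m • xp i m) →
          ((qc : ℝ) ^ N)⁻¹ * ∑ i : Fin N → Fin qc,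
              (quadForm Wt (fun n => xp i n - xstar)
                + sqnormB (fun n => vp i n - vstar n)
                + c * ptbl f xstar (tblUpd x y i))
            ≤ (1 - δ) * (quadForm Wt (fun n => x n - xstar)
                + sqnormB (fun n => v n - vstar n) + c * ptbl f xstar y)) := by
  have hL : 0 < L := hμ.trans_le hμL
  have hq1 : (1 : ℝ) ≤ qc := by exact_mod_cast hqc
  have hq0 : (0 : ℝ) < qc := by linarith
  have hsq : ∀ w : Fin N → Evec p, w ≠ 0 → 0 < sqnormB w := by
    intro w hw
    rw [← DSA.norm_sq_eq_sqnormB (WithLp.toLp 2 w)]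
    have : WithLp.toLp 2 w ≠ 0 := fun h => hw (by simpa using h)
    positivity
  have hγ0 : 0 < γ := by
    obtain ⟨w, hw, hwγ⟩ := hγach
    have h := DSA.quadForm_pos_of_posDef hWtpos hw
    rw [hwγ] at h
    exact pos_of_mul_pos_left h (hsq w hw).le
  have hγΓ : γ ≤ Γ := by
    obtain ⟨w, hw, hwγ⟩ := hγach
    have h := hΓ w
    rw [hwγ] at h
    exact le_of_mul_le_mul_right h (hsq w hw)
  have hΓ0 : 0 < Γ := hγ0.trans_le hγΓ
  have hη0 : 0 < η := by rw [hηdef]; positivity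
  have hα0 : 0 < α := by rw [hαdef]; positivity
  rw [hκf] at hδdef
  obtain ⟨hδ0, hδ2, hδΓ, hδ1, hδ3⟩ :=
    DSA.contraction_factor_bounds hμ hμL hγ0 hγΓ hγ'pos hq1 hκg hδdef
  have hc0 : 0 < c := by rw [hcdef]; positivity
  refine ⟨?_, ⟨hα0, ?_⟩, ⟨?_, ?_⟩, ⟨hδ0, by linarith⟩, ?_⟩
  · rw [hηdef]
    have : L ^ 2 * qc / (μ * qc) = L ^ 2 / μ := by field_simp
    rw [this]
    have : 2 * L ^ 2 / μ = L ^ 2 / μ + L ^ 2 / μ := by ring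
    linarith
  · have h : γ / (2 * η) = 2 * α := by
      rw [hηdef, hαdef]; field_simp; ring
    linarith
  · have h : c = 4 * α * L * qc / η * (1 + μ / (4 * L)) := by
      rw [hcdef, hηdef, hαdef]; field_simp; ring
    have h1 : 0 < 4 * α * L * qc / η * (μ / (4 * L)) := by positivity
    rw [h]; linarith
  · have h : 4 * α * μ * qc / L - 2 * α * qc * (2 * L - μ) / η
        = c + qc * γ * μ ^ 2 / (4 * L ^ 3) * (μ / (4 * L)) := by
      rw [hcdef, hηdef, hαdef]; field_simp; ring
    have h1 : 0 < qc * γ * μ ^ 2 / (4 * L ^ 3) * (μ / (4 * L)) := by positivity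
    rw [h]; linarith
  intro x v y hv xp vp hxp hvp
  have hdiffmat : Wt - W = 1 - Wt := by
    have h : (2 : ℝ) • Wt = 1 + W := by rw [hWtdef, smul_smul]; norm_num
    rw [two_smul] at h
    rw [sub_eq_sub_iff_add_eq_add, h]
  have hUsym : Us.IsSymm := by
    simpa [Matrix.IsHermitian, Matrix.IsSymm] using hUs.isHermitian
  set A := DSA.blockMap (p := p) Wt with hAdef
  set U := DSA.blockMap (p := p) Us with hUdef
  have hA : A.IsSymmetric := DSA.blockMap_isSymmetric hWtsym
  have hU : U.IsSymmetric := DSA.blockMap_isSymmetric hUsym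
  have hUU' : ∀ w, U (U w) = DSA.blockMap (Wt - W) w := fun w => by
    rw [← hUs2, DSA.blockMap_mul]
  have hUU : ∀ w, U (U w) = w - A w := fun w => by
    rw [hUU', hdiffmat, DSA.blockMap_one_sub]
  have hAγ : ∀ w, γ * ‖w‖ ^ 2 ≤ ⟪w, A w⟫ := fun w => by
    rw [DSA.inner_blockMap, DSA.norm_sq_eq_sqnormB]; exact hγ w
  have hAΓ : ∀ w, ⟪w, A w⟫ ≤ Γ * ‖w‖ ^ 2 := fun w => by
    rw [DSA.inner_blockMap, DSA.norm_sq_eq_sqnormB]; exact hΓ w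
  have hUγ' : ∀ a, γ' * ‖U a‖ ^ 2 ≤ ‖U (U a)‖ ^ 2 := by
    intro a
    obtain ⟨b, hb⟩ := DSA.exists_apply_apply_eq hU a
    have h := hγ' (U a) ⟨b, fun n => by rw [← hb, hUU']; rfl⟩
    rwa [← DSA.norm_sq_eq_sqnormB, ← DSA.inner_blockMap, ← hUU', ← hU,
      real_inner_self_eq_norm_sq] at h
  have hUconst : U (WithLp.toLp 2 fun _ => xstar) = 0 := by
    rw [← inner_self_eq_zero (𝕜 := ℝ), hU, hUU',
      DSA.blockMap_const ((hnulldiff _).2 ⟨1, rfl⟩), inner_zero_right]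
  have hAconst : A (WithLp.toLp 2 fun _ => xstar) = WithLp.toLp 2 fun _ => xstar := by
    have h := DSA.blockMap_const hnullWt xstar
    rw [DSA.blockMap_one_sub, sub_eq_zero] at h
    exact h.symm
  set gs : Fin N → Evec p := fun n => gradient (locf f n) xstar with hgs
  have hUv : U (WithLp.toLp 2 vstar) = -(α • WithLp.toLp 2 gs) := by
    rw [eq_neg_iff_add_eq_zero, add_comm]
    ext1 n
    exact hvstar n
  set e : DSA.BlockSpace N p := WithLp.toLp 2 fun n => x n - xstar with he
  set w : DSA.BlockSpace N p := WithLp.toLp 2 fun n => v n - vstar n with hw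
  have hwrange : ∃ b, w = U b := by
    obtain ⟨a, ha⟩ := hv
    obtain ⟨b, hb⟩ := hvstarcol
    refine ⟨WithLp.toLp 2 a - WithLp.toLp 2 b, ?_⟩
    rw [map_sub]
    ext1 n
    change v n - vstar n = _
    rw [ha, hb]; rfl
  set r : (Fin N → Fin qc) → DSA.BlockSpace N p :=
    fun i => WithLp.toLp 2 fun n => hatg f x y n (i n) - gs n with hr
  set D : ℝ := ∑ n, (qc : ℝ)⁻¹ * ∑ j, ⟪x n - xstar, hatg f x y n j - gs n⟫ with hD
  set H : ℝ := ∑ n, (qc : ℝ)⁻¹ * ∑ j, ‖hatg f x y n j - gs n‖ ^ 2 with hH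
  have hstep : ∀ i, quadForm Wt (fun n => xp i n - xstar) + sqnormB (fun n => vp i n - vstar n)
      ≤ (1 - δ) * (⟪e, A e⟫ + ‖w‖ ^ 2) - 2 * α * ⟪e, r i⟫
        + (α / η + δ * (4 * α ^ 2 / γ')) * ‖r i‖ ^ 2 + δ * (Γ * ‖e‖ ^ 2) := by
    intro i
    set d : DSA.BlockSpace N p := WithLp.toLp 2 fun n => xp i n - xstar with hd
    have hde : d = A e - α • r i - U w := by
      have hee : e = WithLp.toLp 2 x - WithLp.toLp 2 (fun _ => xstar) := rfl
      have hww : w = WithLp.toLp 2 v - WithLp.toLp 2 vstar := rfl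
      rw [hee, hww, map_sub, map_sub, hAconst, hUv]
      ext1 n
      change xp i n - xstar = (∑ m, Wt n m • x m) - xstar - α • (hatg f x y n (i n) - gs n)
        - ((∑ m, Us n m • v m) - -(α • gs n))
      rw [hxp, smul_sub]
      abel
    have hvd : (WithLp.toLp 2 fun n => vp i n - vstar n : DSA.BlockSpace N p) = w + U d := by
      have hdd : d = WithLp.toLp 2 (xp i) - WithLp.toLp 2 (fun _ => xstar) := rfl
      rw [hdd, map_sub, hUconst, sub_zero]
      ext1 n
      change vp i n - vstar n = v n - vstar n + ∑ m, Us n m • xp i m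
      rw [hvp]
      abel
    have h := DSA.primal_dual_step_le hA hU hUU hγ0 hΓ0 hγ'pos hη0 hα0 hδ0.le hAγ hAΓ hUγ'
      (by rw [hαdef, hηdef]; field_simp; norm_num) hδ2 hδΓ hwrange hde
    rwa [← hvd, DSA.inner_blockMap, DSA.norm_sq_eq_sqnormB] at h
  set G : ℝ := ∑ n, DSA.bregman (locf f n) (x n) xstar with hG
  set T : ℝ := ptbl f xstar y with hT
  have hTsum : T = ∑ n, (qc : ℝ)⁻¹ * ∑ i, DSA.bregman (f n i) (y n i) xstar := rfl
  have hR : ‖e‖ ^ 2 = ∑ n, ‖x n - xstar‖ ^ 2 := PiLp.norm_sq_eq_of_L2 _ e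
  have hlocf : ∀ n a b, DSA.bregman (locf f n) a b
      = (qc : ℝ)⁻¹ * ∑ i, DSA.bregman (f n i) a b :=
    fun n => DSA.bregman_average (hdiff n)
  have hgradf : ∀ n a, gradient (locf f n) a = (qc : ℝ)⁻¹ • ∑ i, gradient (f n i) a :=
    fun n a => (DSA.hasGradientAt_average (hdiff n) a).gradient
  have hbl : ∀ n i a b, μ / 2 * ‖a - b‖ ^ 2 ≤ DSA.bregman (f n i) a b :=
    fun n i => DSA.le_bregman_of_strongConvexOn (hdiff n i) (hsc n i)
  have hbu : ∀ n i a b, DSA.bregman (f n i) a b ≤ L / 2 * ‖a - b‖ ^ 2 :=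
    fun n i => DSA.bregman_le_of_lipschitz (hdiff n i) (hlip n i)
  have hconst : ∀ k : ℝ, (qc : ℝ)⁻¹ * ∑ _i : Fin qc, k = k := fun k => by simp [hq0.ne']
  have hll : ∀ n a b, μ / 2 * ‖a - b‖ ^ 2 ≤ DSA.bregman (locf f n) a b := by
    intro n a b
    rw [hlocf, ← hconst (μ / 2 * ‖a - b‖ ^ 2)]
    gcongr
    exact hbl n _ a b
  have hlu : ∀ n a b, DSA.bregman (locf f n) a b ≤ L / 2 * ‖a - b‖ ^ 2 := by
    intro n a b
    rw [hlocf, ← hconst (L / 2 * ‖a - b‖ ^ 2)]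
    gcongr
    exact hbu n _ a b
  have hDR : μ * ‖e‖ ^ 2 ≤ D := by
    rw [hR, Finset.mul_sum]
    refine Finset.sum_le_sum fun n _ => ?_
    have h : (qc : ℝ)⁻¹ * ∑ j, ⟪x n - xstar, hatg f x y n j - gs n⟫
        = ⟪x n - xstar, gradient (locf f n) (x n) - gs n⟫ := by
      rw [hgradf]
      exact DSA.average_inner_saga hqc _ _ _ _
    rw [h, DSA.inner_gradient_sub_eq_bregman_add]
    have h1 := hll n (x n) xstar
    have h2 := hll n xstar (x n)
    rw [norm_sub_rev] at h2
    linarith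
  have hHT : H ≤ 4 * L * T + (4 * L - 2 * μ) * G := by
    rw [hTsum, hG, Finset.mul_sum, Finset.mul_sum, ← Finset.sum_add_distrib]
    exact Finset.sum_le_sum fun n _ => DSA.average_norm_sq_saga_le_bregman hqc hμ hL (hdiff n)
      (hsc n) (hlip n) (x n) xstar (y n)
  have hGl : μ / 2 * ‖e‖ ^ 2 ≤ G := by
    rw [hR, Finset.mul_sum]
    exact Finset.sum_le_sum fun n _ => hll n _ _
  have hGu : G ≤ L / 2 * ‖e‖ ^ 2 := by
    rw [hR, Finset.mul_sum]
    exact Finset.sum_le_sum fun n _ => hlu n _ _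
  have hT0 : 0 ≤ T := by
    rw [hTsum]
    refine Finset.sum_nonneg fun n _ => mul_nonneg (by positivity) (Finset.sum_nonneg fun i _ => ?_)
    exact le_trans (by positivity) (hbl n i (y n i) xstar)
  have hETab : ((qc : ℝ) ^ N)⁻¹ * ∑ i : Fin N → Fin qc, ptbl f xstar (tblUpd x y i)
      = (1 - (qc : ℝ)⁻¹) * T + (qc : ℝ)⁻¹ * G := by
    refine (DSA.average_sum_apply hqc fun n j => (qc : ℝ)⁻¹ *
      ∑ k, DSA.bregman (f n k) (Function.update (y n) j (x n) k) xstar).trans ?_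
    rw [hTsum, hG, Finset.mul_sum, Finset.mul_sum, ← Finset.sum_add_distrib]
    refine Finset.sum_congr rfl fun n _ => ?_
    rw [hlocf]
    exact DSA.average_sum_update hqc (fun k z => DSA.bregman (f n k) z xstar) (y n) (x n)
  have hED : ((qc : ℝ) ^ N)⁻¹ * ∑ i, ⟪e, r i⟫ = D := by
    simp only [PiLp.inner_apply]
    exact DSA.average_sum_apply hqc fun n j => ⟪x n - xstar, hatg f x y n j - gs n⟫
  have hEH : ((qc : ℝ) ^ N)⁻¹ * ∑ i, ‖r i‖ ^ 2 = H := by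
    refine (congrArg _ (Finset.sum_congr rfl fun i _ =>
      PiLp.norm_sq_eq_of_L2 _ (r i))).trans ?_
    exact DSA.average_sum_apply hqc fun n j => ‖hatg f x y n j - gs n‖ ^ 2
  have hEconst : ∀ k : ℝ, ((qc : ℝ) ^ N)⁻¹ * ∑ _i : Fin N → Fin qc, k = k := by
    intro k
    simp [hq0.ne']
  have hsum := mul_le_mul_of_nonneg_left
    (Finset.sum_le_sum fun i (_ : i ∈ Finset.univ) => hstep i)
    (by positivity : 0 ≤ ((qc : ℝ) ^ N)⁻¹)
  conv_rhs at hsum =>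
    rw [Finset.sum_add_distrib, Finset.sum_add_distrib, Finset.sum_sub_distrib, mul_add, mul_add,
      mul_sub, hEconst, hEconst, ← Finset.mul_sum, ← Finset.mul_sum, mul_left_comm, hED,
      mul_left_comm, hEH]
  have herr := DSA.averaged_error_le hμ hμL hγ0 hΓ0 hγ'pos hq0 hηdef hαdef hcdef hδ0 hδ1 hδ3
    hDR hHT hGl hGu (sq_nonneg ‖e‖) hT0
  have heA : quadForm Wt (fun n => x n - xstar) = ⟪e, A e⟫ := (DSA.inner_blockMap Wt e).symm
  have hwn : sqnormB (fun n => v n - vstar n) = ‖w‖ ^ 2 := (DSA.norm_sq_eq_sqnormB w).symm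
  rw [Finset.sum_add_distrib, mul_add, ← Finset.mul_sum, mul_left_comm, hETab, heA, hwn]
  linarith
end
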